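/- arXiv:1904.04682 — 2 statements merged into one kernel-verified Lean document; each statement's English description precedes it below -/
import Mathlib

section
/- Let m ≥ 2 be an integer and let D = (V,E,w) be a vertex-weighted oriented m-partite graph of the first class (with m parts). Assume w(x) = 1 for every source vertex of D (i.e., every vertex of V_1) and w(x) ≥ 2 for every x ∈ V \ (V_1 ⊔ V_m). Then the Castelnuovo–Mumford regularity of the edge ideal satisfies reg(I(D)) = (Σ_{x ∈ V} w(x)) − |V| + 2. -/
open MvPolynomial

noncomputable section

namespace WOG

variable {k : Type} [Field k]

/-- The maximal graded ideal `(x : x ∈ V)` of the polynomial ring. -/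
def mIdeal (k V : Type) [Field k] : Ideal (MvPolynomial V k) :=
  Ideal.span (Set.range (X : V → MvPolynomial V k))

/-- The edge ideal `I(D) = (x * y^{w(y)} : (x,y) ∈ E)` of a vertex-weighted
oriented graph `D = (V, E, w)`. -/
def edgeIdeal (k : Type) [Field k] {V : Type} (E : Set (V × V)) (w : V → ℕ) :
    Ideal (MvPolynomial V k) :=
  Ideal.span {p : MvPolynomial V k | ∃ e ∈ E, p = X e.1 * X e.2 ^ w e.2}

/-- A minimal graded free resolution `⋯ → F₁ → F₀ → I → 0` of an ideal
`I` of the polynomial ring `S = k[x : x ∈ V]`, where `Fᵢ` is the graded free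
module with (finite) homogeneous basis `ι i` whose element `a` sits in degree
`deg i a` (i.e. `Fᵢ = ⊕_a S(- deg i a)`), the maps are graded (degree-preserving)
`S`-linear maps, the complex is exact, and all the matrix entries of the
differentials lie in the maximal graded ideal `𝔪 = (x : x ∈ V)` (minimality). -/
structure MinFreeRes {V : Type} (I : Ideal (MvPolynomial V k)) where
  ι : ℕ → Type
  finite : ∀ i, Finite (ι i)
  deg : ∀ i, ι i → ℕ
  aug : ((ι 0) →₀ MvPolynomial V k) →ₗ[MvPolynomial V k] MvPolynomial V k
  d : ∀ i, ((ι (i + 1)) →₀ MvPolynomial V k) →ₗ[MvPolynomial V k] ((ι i) →₀ MvPolynomial V k)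
  aug_range : LinearMap.range aug = I
  exact_zero : LinearMap.range (d 0) = LinearMap.ker aug
  exact_succ : ∀ i, LinearMap.range (d (i + 1)) = LinearMap.ker (d i)
  aug_homog : ∀ a, (aug (Finsupp.single a 1)).IsHomogeneous (deg 0 a)
  d_homog : ∀ i a b, (d i (Finsupp.single a 1)) b = 0 ∨
      ∃ e, deg (i + 1) a = deg i b + e ∧ ((d i (Finsupp.single a 1)) b).IsHomogeneous e
  minimal : ∀ i a b, (d i (Finsupp.single a 1)) b ∈ mIdeal k V

/-- The graded Betti number `β_{i,j}(I)`, read off from a minimal graded free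
resolution: the number of basis elements of `Fᵢ` of degree `j`. -/
def MinFreeRes.betti {V : Type} {I : Ideal (MvPolynomial V k)} (R : MinFreeRes I)
    (i j : ℕ) : ℕ :=
  Nat.card {a : R.ι i // R.deg i a = j}

/-- The set `{j - i : β_{i,j}(I) ≠ 0}`; its greatest element is the
Castelnuovo–Mumford regularity `reg I`. -/
def MinFreeRes.regSet {V : Type} {I : Ideal (MvPolynomial V k)} (R : MinFreeRes I) :
    Set ℤ :=
  {t : ℤ | ∃ i j : ℕ, R.betti i j ≠ 0 ∧ t = (j : ℤ) - (i : ℤ)}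

/-- The set `{i : β_{i,j}(I) ≠ 0 for some j}`; its greatest element is the
projective dimension `pd I`. -/
def MinFreeRes.pdSet {V : Type} {I : Ideal (MvPolynomial V k)} (R : MinFreeRes I) :
    Set ℕ :=
  {i : ℕ | ∃ j : ℕ, R.betti i j ≠ 0}

/-- The set of lengths of `I`-regular sequences contained in the maximal graded
ideal `𝔪 = (x : x ∈ V)`; its greatest element is `depth I`. -/
def depthSet (k : Type) [Field k] {V : Type} (I : Ideal (MvPolynomial V k)) : Set ℕ :=
  {n : ℕ | ∃ rs : List (MvPolynomial V k), rs.length = n ∧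
    (∀ r ∈ rs, r ∈ mIdeal k V) ∧ RingTheory.Sequence.IsRegular (↥I) rs}

end WOG

namespace WOG

/-! ### Koszul complexes of commuting families of endomorphisms -/

/-- The underlying group of the Koszul complex of `M` on the list `l` of variables. -/
def Koszul (V M : Type) : List V → Type
  | [] => M
  | _ :: l => Koszul V M l × Koszul V M l

namespace Koszul

variable {V M N P : Type}

/-- The chain with components `a` and `b` in the mapping cone. -/
def cons (x : V) {l : List V} (a b : Koszul V M l) : Koszul V M (x :: l) := (a, b)

theorem exists_eq_cons {x : V} {l : List V} (c : Koszul V M (x :: l)) :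
    ∃ a b, c = cons x a b := ⟨c.1, c.2, rfl⟩

theorem cons_inj {x : V} {l : List V} {a b a' b' : Koszul V M l} :
    cons x a b = cons x a' b' ↔ a = a' ∧ b = b' := Prod.ext_iff

variable [AddCommGroup M] [AddCommGroup N] [AddCommGroup P]

instance instAddCommGroup : (l : List V) → AddCommGroup (Koszul V M l)
  | [] => inferInstanceAs (AddCommGroup M)
  | _ :: l =>
    letI := instAddCommGroup l
    inferInstanceAs (AddCommGroup (Koszul V M l × Koszul V M l))

/-- Functoriality of the Koszul complex in the coefficient group. -/
def map (φ : M →+ N) : (l : List V) → Koszul V M l →+ Koszul V N l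
  | [] => φ
  | _ :: l => (map φ l).prodMap (map φ l)

/-- The total Koszul differential: an iterated mapping cone of the endomorphisms `T x`. -/
def d (T : V → M →+ M) : (l : List V) → Koszul V M l →+ Koszul V M l
  | [] => 0
  | x :: l => ((d T l).coprod (map (T x) l)).prod (-(d T l).comp (AddMonoidHom.snd _ _))

/-- The chains of homological degree `i` all of whose entries lie in `A`. -/
def chains (A : AddSubgroup M) : (l : List V) → ℤ → AddSubgroup (Koszul V M l)
  | [], i => if i = 0 then A else ⊥
  | _ :: l, i => (chains A l i).prod (chains A l (i - 1))

/-- The inclusion of the entry in homological degree `0`. -/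
def bot : (l : List V) → M → Koszul V M l
  | [], m => m
  | _ :: l, m => (bot l m, 0)

/-- The entry in homological degree `0`. -/
def fstEntry : (l : List V) → Koszul V M l →+ M
  | [] => AddMonoidHom.id M
  | _ :: l => (fstEntry l).comp (AddMonoidHom.fst _ _)

/-- The inclusion of the entry in top homological degree. -/
def top : (l : List V) → M →+ Koszul V M l
  | [] => AddMonoidHom.id M
  | _ :: l => AddMonoidHom.prod 0 (top l)

theorem cons_sub (x : V) {l : List V} (a b a' b' : Koszul V M l) :
    cons x a b - cons x a' b' = cons x (a - a') (b - b') := rfl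

theorem cons_zero_zero (x : V) (l : List V) : cons x (0 : Koszul V M l) 0 = 0 := rfl

theorem cons_eq_zero {x : V} {l : List V} {a b : Koszul V M l} :
    cons x a b = 0 ↔ a = 0 ∧ b = 0 := Prod.ext_iff

theorem map_cons (φ : M →+ N) (x : V) (l : List V) (a b : Koszul V M l) :
    map φ (x :: l) (cons x a b) = cons x (map φ l a) (map φ l b) := rfl

theorem d_cons (T : V → M →+ M) (x : V) (l : List V) (a b : Koszul V M l) :
    d T (x :: l) (cons x a b) = cons x (d T l a + map (T x) l b) (-d T l b) := rfl

theorem top_cons (x : V) (l : List V) (m : M) : top (x :: l) m = cons x 0 (top l m) := rfl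

theorem mem_chains_cons {A : AddSubgroup M} {x : V} {l : List V} {i : ℤ}
    {a b : Koszul V M l} :
    cons x a b ∈ chains A (x :: l) i ↔ a ∈ chains A l i ∧ b ∈ chains A l (i - 1) := Iff.rfl

theorem mem_chains_nil {A : AddSubgroup M} {i : ℤ} {c : M} :
    (show Koszul V M [] from c) ∈ chains A [] i ↔ (i = 0 ∧ c ∈ A) ∨ c = 0 := by
  change c ∈ (if i = 0 then A else ⊥ : AddSubgroup M) ↔ _
  split_ifs with hi
  · exact ⟨fun h => Or.inl ⟨hi, h⟩, fun h => h.elim And.right fun h => h ▸ zero_mem _⟩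
  · exact AddSubgroup.mem_bot.trans ⟨Or.inr, fun h => h.elim (fun h => absurd h.1 hi) id⟩

theorem map_map (ψ : N →+ P) (φ : M →+ N) (l : List V) (c : Koszul V M l) :
    map ψ l (map φ l c) = map (ψ.comp φ) l c := by
  induction l with
  | nil => rfl
  | cons x l ih =>
    obtain ⟨a, b, rfl⟩ := exists_eq_cons c
    simp only [map_cons, ih]

theorem sum_map {ι : Type} (s : Finset ι) (φ : ι → M →+ N) (l : List V) (c : Koszul V M l) :
    ∑ a ∈ s, map (φ a) l c = map (∑ a ∈ s, φ a) l c := by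
  induction l with
  | nil => exact (AddMonoidHom.finsetSum_apply φ s c).symm
  | cons x l ih =>
    obtain ⟨a, b, rfl⟩ := exists_eq_cons c
    simp only [map_cons, ← ih]
    exact Prod.ext Prod.fst_sum Prod.snd_sum

theorem map_id (l : List V) (c : Koszul V M l) : map (AddMonoidHom.id M) l c = c := by
  induction l with
  | nil => rfl
  | cons x l ih =>
    obtain ⟨a, b, rfl⟩ := exists_eq_cons c
    simp only [map_cons, ih]

theorem d_map {T : V → M →+ M} {T' : V → N →+ N} {φ : M →+ N} {l : List V}
    (h : ∀ x ∈ l, ∀ m, φ (T x m) = T' x (φ m)) (c : Koszul V M l) :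
    d T' l (map φ l c) = map φ l (d T l c) := by
  induction l with
  | nil => exact (map_zero φ).symm
  | cons x l ih =>
    obtain ⟨a, b, rfl⟩ := exists_eq_cons c
    have hx : (T' x).comp φ = φ.comp (T x) :=
      AddMonoidHom.ext fun m => (h x List.mem_cons_self m).symm
    have ih' := ih fun y hy => h y (List.mem_cons_of_mem _ hy)
    simp only [map_cons, d_cons, ih', map_add, map_neg, map_map, hx]

theorem d_d {T : V → M →+ M} (hT : ∀ x y m, T x (T y m) = T y (T x m)) (l : List V)
    (c : Koszul V M l) : d T l (d T l c) = 0 := by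
  induction l with
  | nil => rfl
  | cons x l ih =>
    obtain ⟨a, b, rfl⟩ := exists_eq_cons c
    simp only [d_cons, map_add, map_neg, ih, d_map (fun y _ m => hT x y m), cons_eq_zero]
    simp

section chains

variable {A B C : AddSubgroup M} {l : List V} {i : ℤ}

theorem map_mem_chains {φ : M →+ N} {B : AddSubgroup N} (h : ∀ m ∈ A, φ m ∈ B)
    {c : Koszul V M l} (hc : c ∈ chains A l i) : map φ l c ∈ chains B l i := by
  induction l generalizing i with
  | nil =>
    refine mem_chains_nil.2 ((mem_chains_nil.1 hc).imp (And.imp_right (h _)) fun hc => ?_)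
    exact (congrArg φ hc).trans (map_zero φ)
  | cons x l ih =>
    obtain ⟨a, b, rfl⟩ := exists_eq_cons c
    exact ⟨ih hc.1, ih hc.2⟩

theorem chains_mono (h : A ≤ B) {c : Koszul V M l} (hc : c ∈ chains A l i) :
    c ∈ chains B l i := by
  have := map_mem_chains (φ := AddMonoidHom.id M) h hc
  rwa [map_id] at this

theorem d_mem_chains_of_mem {T : V → M →+ M} (h : ∀ x ∈ l, ∀ m ∈ A, T x m ∈ B)
    {c : Koszul V M l} (hc : c ∈ chains A l i) : d T l c ∈ chains B l (i - 1) := by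
  induction l generalizing i with
  | nil => exact zero_mem _
  | cons x l ih =>
    obtain ⟨a, b, rfl⟩ := exists_eq_cons c
    have ih' {i c} := ih (i := i) (c := c) fun y hy => h y (List.mem_cons_of_mem _ hy)
    rw [d_cons, mem_chains_cons]
    exact ⟨add_mem (ih' hc.1) (map_mem_chains (h x List.mem_cons_self) hc.2),
      neg_mem (ih' hc.2)⟩

theorem d_mem_chains {T : V → M →+ M} (h : ∀ x, ∀ m ∈ A, T x m ∈ B)
    {c : Koszul V M l} (hc : c ∈ chains A l i) : d T l c ∈ chains B l (i - 1) :=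
  d_mem_chains_of_mem (fun x _ => h x) hc

theorem exists_lift {φ : M →+ N} {B : AddSubgroup N} (h : ∀ n ∈ B, ∃ m ∈ A, φ m = n)
    {c : Koszul V N l} (hc : c ∈ chains B l i) : ∃ e ∈ chains A l i, map φ l e = c := by
  induction l generalizing i with
  | nil =>
    obtain ⟨hi, hc⟩ | hc := mem_chains_nil.1 hc
    · obtain ⟨m, hm, hmc⟩ := h _ hc
      exact ⟨m, mem_chains_nil.2 (Or.inl ⟨hi, hm⟩), hmc⟩
    · exact ⟨0, zero_mem _, (map_zero φ).trans hc.symm⟩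
  | cons x l ih =>
    obtain ⟨a, b, rfl⟩ := exists_eq_cons c
    obtain ⟨a', ha, rfl⟩ := ih hc.1
    obtain ⟨b', hb, rfl⟩ := ih hc.2
    exact ⟨cons x a' b', ⟨ha, hb⟩, rfl⟩

theorem mem_chains_of_map {φ : M →+ N} {B : AddSubgroup N}
    (h : ∀ m ∈ A, φ m ∈ B → m ∈ C) {c : Koszul V M l} (hc : c ∈ chains A l i)
    (hφ : map φ l c ∈ chains B l i) : c ∈ chains C l i := by
  induction l generalizing i with
  | nil =>
    obtain ⟨hi, hc⟩ | hc := mem_chains_nil.1 hc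
    · refine mem_chains_nil.2 (Or.inl ⟨hi, h _ hc ?_⟩)
      exact (mem_chains_nil.1 hφ).elim And.right fun hφ => hφ.symm ▸ zero_mem B
    · exact mem_chains_nil.2 (Or.inr hc)
  | cons x l ih =>
    obtain ⟨a, b, rfl⟩ := exists_eq_cons c
    exact ⟨ih hc.1 hφ.1, ih hc.2 hφ.2⟩

theorem exists_decomp {φ : N →+ M} {B : AddSubgroup N}
    (h : ∀ m ∈ C, ∃ a ∈ A, ∃ b ∈ B, m = a + φ b) {c : Koszul V M l}
    (hc : c ∈ chains C l i) :
    ∃ a ∈ chains A l i, ∃ b ∈ chains B l i, c = a + map φ l b := by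
  induction l generalizing i with
  | nil =>
    obtain ⟨hi, hc⟩ | hc := mem_chains_nil.1 hc
    · obtain ⟨a, ha, b, hb, hab⟩ := h _ hc
      exact ⟨a, mem_chains_nil.2 (Or.inl ⟨hi, ha⟩), b, mem_chains_nil.2 (Or.inl ⟨hi, hb⟩), hab⟩
    · refine ⟨0, zero_mem _, 0, zero_mem _, ?_⟩
      rw [map_zero, add_zero]
      exact hc
  | cons x l ih =>
    obtain ⟨c₁, c₂, rfl⟩ := exists_eq_cons c
    obtain ⟨a₁, ha₁, b₁, hb₁, rfl⟩ := ih hc.1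
    obtain ⟨a₂, ha₂, b₂, hb₂, rfl⟩ := ih hc.2
    exact ⟨cons x a₁ a₂, ⟨ha₁, ha₂⟩, cons x b₁ b₂, ⟨hb₁, hb₂⟩, rfl⟩

theorem eq_zero_of_neg (hi : i < 0) {c : Koszul V M l} (hc : c ∈ chains A l i) : c = 0 := by
  induction l generalizing i with
  | nil =>
    exact (mem_chains_nil.1 hc).elim (fun h => absurd h.1 hi.ne) id
  | cons x l ih =>
    obtain ⟨a, b, rfl⟩ := exists_eq_cons c
    exact cons_eq_zero.2 ⟨ih hi hc.1, ih (by omega) hc.2⟩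

theorem eq_zero_of_eq_bot (hA : A = ⊥) {c : Koszul V M l} (hc : c ∈ chains A l i) :
    c = 0 := by
  induction l generalizing i with
  | nil =>
    refine (mem_chains_nil.1 hc).elim (fun h => ?_) id
    exact AddSubgroup.mem_bot.1 (hA ▸ h.2)
  | cons x l ih =>
    obtain ⟨a, b, rfl⟩ := exists_eq_cons c
    exact cons_eq_zero.2 ⟨ih hc.1, ih hc.2⟩

theorem bot_mem_chains {m : M} (hm : m ∈ A) : bot l m ∈ chains A l 0 := by
  induction l with
  | nil => exact mem_chains_nil.2 (Or.inl ⟨rfl, hm⟩)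
  | cons x l ih => exact ⟨ih, zero_mem _⟩

theorem top_mem_chains {m : M} (hm : m ∈ A) : top l m ∈ chains A l l.length := by
  induction l with
  | nil => exact mem_chains_nil.2 (Or.inl ⟨rfl, hm⟩)
  | cons x l ih =>
    rw [top_cons, mem_chains_cons, List.length_cons, Nat.cast_succ, add_sub_cancel_right]
    exact ⟨zero_mem _, ih⟩

theorem eq_zero_of_length_lt (hi : (l.length : ℤ) < i) {c : Koszul V M l}
    (hc : c ∈ chains A l i) : c = 0 := by
  induction l generalizing i with
  | nil =>
    exact (mem_chains_nil.1 hc).elim (fun h => absurd h.1 (by simpa using hi.ne')) id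
  | cons x l ih =>
    obtain ⟨a, b, rfl⟩ := exists_eq_cons c
    rw [List.length_cons, Nat.cast_succ] at hi
    exact cons_eq_zero.2 ⟨ih (by omega) hc.1, ih (by omega) hc.2⟩

theorem exists_eq_top {c : Koszul V M l} (hc : c ∈ chains A l l.length) :
    ∃ m ∈ A, c = top l m := by
  induction l with
  | nil =>
    refine ⟨c, (mem_chains_nil.1 hc).elim And.right fun h => ?_, rfl⟩
    exact h.symm ▸ zero_mem A
  | cons x l ih =>
    obtain ⟨a, b, rfl⟩ := exists_eq_cons c
    have ha : a = 0 := eq_zero_of_length_lt (by simp) hc.1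
    have hb : b ∈ chains A l l.length := by
      have := hc.2
      rwa [List.length_cons, Nat.cast_succ, add_sub_cancel_right] at this
    obtain ⟨m, hm, rfl⟩ := ih hb
    exact ⟨m, hm, cons_inj.2 ⟨ha, rfl⟩⟩

end chains

theorem d_bot (T : V → M →+ M) (l : List V) (m : M) : d T l (bot l m) = 0 := by
  induction l with
  | nil => rfl
  | cons x l ih =>
    change d T (x :: l) (cons x (bot l m) 0) = 0
    rw [d_cons, ih, map_zero, map_zero, neg_zero, add_zero, cons_zero_zero]

theorem fstEntry_bot (l : List V) (m : M) : fstEntry l (bot l m) = m := by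
  induction l with
  | nil => rfl
  | cons x l ih => exact ih

theorem fstEntry_map (φ : M →+ N) (l : List V) (c : Koszul V M l) :
    fstEntry l (map φ l c) = φ (fstEntry l c) := by
  induction l with
  | nil => rfl
  | cons x l ih =>
    obtain ⟨a, b, rfl⟩ := exists_eq_cons c
    exact ih a

theorem fstEntry_d_mem {T : V → M →+ M} {A : AddSubgroup M} (h : ∀ x m, T x m ∈ A)
    (l : List V) (c : Koszul V M l) : fstEntry l (d T l c) ∈ A := by
  induction l with
  | nil => exact zero_mem _
  | cons x l ih =>
    obtain ⟨a, b, rfl⟩ := exists_eq_cons c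
    change fstEntry l (d T l a + map (T x) l b) ∈ A
    rw [map_add, fstEntry_map]
    exact add_mem (ih a) (h x _)

theorem mem_of_top_mem_chains {A : AddSubgroup M} {l : List V} {m : M}
    (h : top l m ∈ chains A l l.length) : m ∈ A := by
  induction l with
  | nil =>
    refine (mem_chains_nil.1 h).elim And.right fun h => ?_
    exact (show m = 0 from h) ▸ zero_mem A
  | cons x l ih =>
    apply ih
    have := h.2
    rwa [List.length_cons, Nat.cast_succ, add_sub_cancel_right] at this

theorem map_top (φ : M →+ N) (l : List V) (m : M) : map φ l (top l m) = top l (φ m) := by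
  induction l with
  | nil => rfl
  | cons x l ih => rw [top_cons, map_cons, ih, map_zero, top_cons]

theorem mem_of_d_top_mem_chains {T : V → M →+ M} {A : AddSubgroup M} {l : List V} {m : M}
    (h : d T l (top l m) ∈ chains A l (l.length - 1)) : ∀ x ∈ l, T x m ∈ A := by
  induction l with
  | nil => exact fun x hx => absurd hx List.not_mem_nil
  | cons y l ih =>
    rw [top_cons, d_cons, map_zero, zero_add, map_top, mem_chains_cons, List.length_cons,
      Nat.cast_succ, add_sub_cancel_right] at h
    intro x hx
    obtain rfl | hx := List.mem_cons.1 hx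
    · exact mem_of_top_mem_chains h.1
    · exact ih (neg_mem_iff.1 h.2) x hx

/-- The inclusion of the Koszul complex on `l` into that on `l' ++ l` as the part of top degree
in the variables of `l'`. -/
def topExt : (l' : List V) → {l : List V} → Koszul V M l →+ Koszul V M (l' ++ l)
  | [], _ => AddMonoidHom.id _
  | _ :: l', _ => AddMonoidHom.prod 0 (topExt l')

theorem topExt_cons (x : V) (l' : List V) {l : List V} (c : Koszul V M l) :
    topExt (x :: l') c = (cons x 0 (topExt l' c) : Koszul V M (x :: (l' ++ l))) := rfl

theorem topExt_mem_chains {A : AddSubgroup M} {l : List V} {i : ℤ} {c : Koszul V M l}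
    (hc : c ∈ chains A l i) (l' : List V) :
    topExt l' c ∈ chains A (l' ++ l) (i + l'.length) := by
  induction l' with
  | nil =>
    rw [List.length_nil, Nat.cast_zero, add_zero]
    exact hc
  | cons x l' ih =>
    rw [topExt_cons]
    refine ⟨zero_mem _, ?_⟩
    rwa [List.length_cons, Nat.cast_succ, ← add_assoc, add_sub_cancel_right]

theorem map_topExt (φ : M →+ N) (l' : List V) {l : List V} (c : Koszul V M l) :
    map φ (l' ++ l) (topExt l' c) = topExt l' (map φ l c) := by
  induction l' with
  | nil => rfl
  | cons x l' ih =>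
    change map φ (x :: (l' ++ l)) (cons x 0 (topExt l' c)) = _
    rw [map_cons, map_zero, ih, topExt_cons]

theorem d_topExt_cons (T : V → M →+ M) (x : V) (l' : List V) {l : List V}
    (c : Koszul V M l) :
    d T (x :: (l' ++ l)) (topExt (x :: l') c) =
      cons x (map (T x) (l' ++ l) (topExt l' c)) (-d T (l' ++ l) (topExt l' c)) := by
  rw [topExt_cons, d_cons, map_zero, zero_add]

theorem d_topExt_mem_chains {T : V → M →+ M} {A B : AddSubgroup M} {l l' : List V} {i : ℤ}
    {c : Koszul V M l} (hc : c ∈ chains A l i) (hdc : d T l c = 0)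
    (h : ∀ x ∈ l', ∀ m ∈ A, T x m ∈ B) :
    d T (l' ++ l) (topExt l' c) ∈ chains B (l' ++ l) (i + l'.length - 1) := by
  induction l' with
  | nil => exact (show d T l c = 0 from hdc) ▸ zero_mem _
  | cons x l' ih =>
    have hmap := topExt_mem_chains (map_mem_chains (h x List.mem_cons_self) hc) l'
    have ih' := ih fun y hy => h y (List.mem_cons_of_mem _ hy)
    rw [← map_topExt] at hmap
    rw [List.length_cons, Nat.cast_succ, ← add_assoc, add_sub_cancel_right]
    change d T (x :: (l' ++ l)) (topExt (x :: l') c) ∈ chains B (x :: (l' ++ l)) _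
    rw [d_topExt_cons, mem_chains_cons]
    exact ⟨hmap, neg_mem ih'⟩

theorem mem_of_topExt_sub_mem_chains {T : V → M →+ M} {A : AddSubgroup M} {l l' : List V}
    {v m : M}
    (h : topExt l' (d T l (top l v)) - d T (l' ++ l) (top (l' ++ l) m) ∈
      chains A (l' ++ l) ((l' ++ l).length - 1)) :
    (∀ y ∈ l', T y m ∈ A) ∧
      ((∀ x ∈ l, T x (v - m) ∈ A) ∨ ∀ x ∈ l, T x (v + m) ∈ A) := by
  induction l' generalizing m with
  | nil =>
    refine ⟨fun y hy => absurd hy List.not_mem_nil, Or.inl (mem_of_d_top_mem_chains ?_)⟩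
    rw [map_sub, map_sub]
    exact h
  | cons y l' ih =>
    change cons y 0 (topExt l' (d T l (top l v))) - d T (y :: (l' ++ l)) (top (y :: (l' ++ l)) m) ∈
      chains A (y :: (l' ++ l)) ((y :: (l' ++ l)).length - 1) at h
    rw [top_cons, d_cons, map_zero, zero_add, map_top, cons_sub, mem_chains_cons,
      List.length_cons, Nat.cast_succ, add_sub_cancel_right, zero_sub] at h
    have hy := mem_of_top_mem_chains (neg_mem_iff.1 h.1)
    obtain ⟨h₁, h₂⟩ := ih (m := -m) (by
      rw [map_neg, map_neg]
      exact h.2)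
    refine ⟨fun z hz => ?_, ?_⟩
    · obtain rfl | hz := List.mem_cons.1 hz
      · exact hy
      · have := h₁ z hz
        rwa [map_neg, neg_mem_iff] at this
    · rw [sub_neg_eq_add, ← sub_eq_add_neg] at h₂
      exact h₂.symm

/-! ### Exactness in a single degree -/

/-- Every Koszul cycle of homological degree `i` with entries in `A` is the boundary of a chain
with entries in `B`. -/
def Exact (T : V → M →+ M) (l : List V) (A B : AddSubgroup M) (i : ℤ) : Prop :=
  ∀ c ∈ chains A l i, d T l c = 0 → ∃ b ∈ chains B l (i + 1), d T l b = c

variable {T : V → M →+ M} {l : List V}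

theorem exact_of_neg {A B : AddSubgroup M} {i : ℤ} (hi : i < 0) : Exact T l A B i :=
  fun c hc _ => ⟨0, zero_mem _, by rw [map_zero, eq_zero_of_neg hi hc]⟩

section LongExactSequence

variable {T' : V → N →+ N} {φ : M →+ N} {G Z : ℤ → AddSubgroup M} {H : ℤ → AddSubgroup N}

theorem Exact.of_quotient (hT : ∀ x y m, T x (T y m) = T y (T x m))
    (hφ : ∀ x m, φ (T x m) = T' x (φ m)) (hG : ∀ x e, ∀ m ∈ G e, T x m ∈ G (e + 1))
    (hZG : ∀ e, Z e ≤ G e) (hφZ : ∀ e, ∀ m ∈ Z e, φ m = 0)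
    (hGH : ∀ e, ∀ m ∈ G e, φ m ∈ H e) (hsurj : ∀ e, ∀ n ∈ H e, ∃ m ∈ G e, φ m = n)
    (hker : ∀ e, ∀ m ∈ G e, φ m = 0 → m ∈ Z e) {s e : ℤ}
    (h₁ : Exact T l (G e) (G (e - 1)) s) (h₂ : Exact T l (Z (e + 1)) (Z e) (s - 1)) :
    Exact T' l (H e) (H (e - 1)) s := by
  intro c hc hdc
  obtain ⟨g, hg, rfl⟩ := exists_lift (hsurj e) hc
  rw [d_map (fun x _ => hφ x)] at hdc
  have hdg : d T l g ∈ chains (Z (e + 1)) l (s - 1) :=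
    mem_chains_of_map (φ := φ) (B := ⊥)
      (fun m hm h => hker _ m hm (by rwa [AddSubgroup.mem_bot] at h))
      (d_mem_chains (fun x => hG x e) hg) (hdc ▸ zero_mem _)
  obtain ⟨b, hb, hdb⟩ := h₂ _ hdg (d_d hT l g)
  rw [sub_add_cancel] at hb
  obtain ⟨f, hf, hdf⟩ := h₁ (g - b) (sub_mem hg (chains_mono (hZG e) hb))
    (by rw [map_sub, hdb, sub_self])
  refine ⟨map φ l f, map_mem_chains (hGH _) hf, ?_⟩
  have hb0 : map φ l b = 0 :=
    eq_zero_of_eq_bot (A := ⊥) rfl (map_mem_chains (fun m hm => hφZ e m hm) hb)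
  rw [d_map (fun x _ => hφ x), hdf, map_sub, hb0, sub_zero]

theorem Exact.of_connecting (hT : ∀ x y m, T x (T y m) = T y (T x m))
    (hφ : ∀ x m, φ (T x m) = T' x (φ m)) (hG : ∀ x e, ∀ m ∈ G e, T x m ∈ G (e + 1))
    (hφZ : ∀ e, ∀ m ∈ Z e, φ m = 0)
    (hGH : ∀ e, ∀ m ∈ G e, φ m ∈ H e) (hsurj : ∀ e, ∀ n ∈ H e, ∃ m ∈ G e, φ m = n)
    (hker : ∀ e, ∀ m ∈ G e, φ m = 0 → m ∈ Z e) {s e : ℤ}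
    (h₁ : Exact T l (Z (e + 1)) (G e) s) (h₂ : Exact T' l (H e) (H (e - 1)) (s + 1)) :
    Exact T l (Z (e + 1)) (Z e) s := by
  intro c hc hdc
  obtain ⟨b, hb, hdb⟩ := h₁ c hc hdc
  have hc0 : map φ l c = 0 :=
    eq_zero_of_eq_bot (A := ⊥) rfl (map_mem_chains (fun m hm => hφZ _ m hm) hc)
  obtain ⟨f, hf, hdf⟩ := h₂ _ (map_mem_chains (hGH e) hb)
    (by rw [d_map (fun x _ => hφ x), hdb, hc0])
  obtain ⟨g, hg, rfl⟩ := exists_lift (hsurj _) hf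
  have hdg : d T l g ∈ chains (G e) l (s + 1) := by
    have := d_mem_chains (fun x m hm => hG x (e - 1) m hm) hg
    rwa [sub_add_cancel, add_sub_cancel_right] at this
  refine ⟨b - d T l g, ?_, by rw [map_sub, d_d hT, sub_zero, hdb]⟩
  refine mem_chains_of_map (φ := φ) (B := ⊥)
    (fun m hm h => hker _ m hm (by rwa [AddSubgroup.mem_bot] at h)) (sub_mem hb hdg) ?_
  rw [map_sub, ← hdf, d_map (fun x _ => hφ x), sub_self]
  exact zero_mem _

end LongExactSequence

section Colon

variable {φ : M →+ M} {I J C S : ℤ → AddSubgroup M}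

theorem Exact.of_colon (hT : ∀ x y m, T x (T y m) = T y (T x m))
    (hφ : ∀ x m, φ (T x m) = T x (φ m)) (hI : ∀ x e, ∀ m ∈ I e, T x m ∈ I (e + 1))
    (hS : ∀ x e, ∀ m ∈ S e, T x m ∈ S (e + 1)) (hIC : ∀ e, I e ≤ C e)
    (hC : ∀ e, ∀ m ∈ C (e + 1), ∃ a ∈ I (e + 1), ∃ b ∈ S e, m = a + φ b)
    (hJ : ∀ e, ∀ m ∈ S e, φ m ∈ I (e + 1) → m ∈ J e)
    (hJI : ∀ e, ∀ m ∈ J e, φ m ∈ I (e + 1)) {i e : ℤ}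
    (h₁ : Exact T l (J e) (J (e - 1)) i) (h₂ : Exact T l (C (e + 1)) (C e) i) :
    Exact T l (I (e + 1)) (I e) i := by
  intro c hc hdc
  obtain ⟨b, hb, rfl⟩ := h₂ c (chains_mono (hIC _) hc) hdc
  obtain ⟨b₁, hb₁, b₂, hb₂, rfl⟩ := exists_decomp
    (fun m hm => by simpa only [sub_add_cancel] using hC (e - 1) m (by rwa [sub_add_cancel])) hb
  have hdb₁ : d T l b₁ ∈ chains (I (e + 1)) l i := by
    simpa only [add_sub_cancel_right] using d_mem_chains (fun x m hm => hI x e m hm) hb₁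
  have hdb₂ : d T l b₂ ∈ chains (S e) l i := by
    simpa only [add_sub_cancel_right, sub_add_cancel] using
      d_mem_chains (fun x m hm => hS x (e - 1) m hm) hb₂
  rw [map_add, d_map (fun x _ m => hφ x m)] at hc
  have hφd : map φ l (d T l b₂) ∈ chains (I (e + 1)) l i := by
    simpa using sub_mem hc hdb₁
  obtain ⟨b₃, hb₃, hdb₃⟩ := h₁ _ (mem_chains_of_map (hJ e) hdb₂ hφd) (d_d hT l b₂)
  refine ⟨b₁ + map φ l b₃, add_mem hb₁ (map_mem_chains (fun m hm => ?_) hb₃), ?_⟩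
  · simpa only [sub_add_cancel] using hJI (e - 1) m hm
  · rw [map_add, map_add, d_map (fun x _ m => hφ x m), d_map (fun x _ m => hφ x m), hdb₃]

theorem Exact.of_add (hT : ∀ x y m, T x (T y m) = T y (T x m))
    (hφ : ∀ x m, φ (T x m) = T x (φ m))
    (hS : ∀ x e, ∀ m ∈ S e, T x m ∈ S (e + 1)) (hIC : ∀ e, I e ≤ C e)
    (hI : ∀ x e, ∀ m ∈ I e, T x m ∈ I (e + 1)) (hJS : ∀ e, J e ≤ S e)
    (hC : ∀ e, ∀ m ∈ C (e + 1), ∃ a ∈ I (e + 1), ∃ b ∈ S e, m = a + φ b)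
    (hSC : ∀ e, ∀ m ∈ S e, φ m ∈ C (e + 1))
    (hJ : ∀ e, ∀ m ∈ S e, φ m ∈ I (e + 1) → m ∈ J e)
    (hJI : ∀ e, ∀ m ∈ J e, φ m ∈ I (e + 1)) {i e : ℤ}
    (h₁ : Exact T l (I (e + 1)) (I e) i) (h₂ : Exact T l (S e) (S (e - 1)) i)
    (h₃ : Exact T l (J (e + 1)) (J e) (i - 1)) :
    Exact T l (C (e + 1)) (C e) i := by
  intro c hc hdc
  obtain ⟨c₁, hc₁, c₂, hc₂, rfl⟩ := exists_decomp (hC e) hc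
  rw [map_add, d_map (fun x _ m => hφ x m)] at hdc
  have hφd : map φ l (d T l c₂) ∈ chains (I (e + 1 + 1)) l (i - 1) := by
    rw [← neg_eq_of_add_eq_zero_right hdc]
    exact neg_mem (d_mem_chains (fun x m hm => hI x _ m hm) hc₁)
  obtain ⟨f, hf, hdf⟩ := h₃ _
    (mem_chains_of_map (hJ (e + 1)) (d_mem_chains (fun x m hm => hS x _ m hm) hc₂) hφd)
    (d_d hT l c₂)
  rw [sub_add_cancel] at hf
  obtain ⟨g, hg, hdg⟩ := h₁ (c₁ + map φ l f) (add_mem hc₁ (map_mem_chains (hJI e) hf))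
    (by rw [map_add, d_map (fun x _ m => hφ x m), hdf, hdc])
  obtain ⟨h, hh, hdh⟩ := h₂ (c₂ - f) (sub_mem hc₂ (chains_mono (hJS e) hf))
    (by rw [map_sub, hdf, sub_self])
  refine ⟨g + map φ l h, add_mem (chains_mono (hIC e) hg)
    (map_mem_chains (fun m hm => ?_) hh), ?_⟩
  · simpa only [sub_add_cancel] using hSC (e - 1) m hm
  · rw [map_add, d_map (fun x _ m => hφ x m), hdg, hdh, map_sub]
    abel

end Colon

end Koszul

end WOG

namespace WOG

/-! ### Graded pieces of monomial ideals -/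

/-- Multiplication by the variable `x` on a module over the polynomial ring. -/
def smulX (k : Type) [Field k] {V : Type} (M : Type) [AddCommGroup M]
    [Module (MvPolynomial V k) M] (x : V) : M →+ M :=
  DistribSMul.toAddMonoidHom M (X x : MvPolynomial V k)

theorem smulX_comm (k : Type) [Field k] {V M : Type} [AddCommGroup M]
    [Module (MvPolynomial V k) M] (x y : V) (m : M) :
    smulX k M x (smulX k M y m) = smulX k M y (smulX k M x m) :=
  smul_comm (X x : MvPolynomial V k) (X y : MvPolynomial V k) m

/-- The polynomials all of whose exponents lie in `P`. -/
def suppIn (k : Type) [Field k] {V : Type} (P : Set (V →₀ ℕ)) :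
    AddSubgroup (MvPolynomial V k) where
  carrier := {f | ∀ α, coeff α f ≠ 0 → α ∈ P}
  zero_mem' := fun α h => absurd (coeff_zero α) h
  add_mem' := fun {f g} hf hg α h => by
    by_cases hfα : coeff α f = 0
    · exact hg α fun hgα => h (by rw [coeff_add, hfα, hgα, add_zero])
    · exact hf α hfα
  neg_mem' := fun {f} hf α h => hf α fun hfα => h (by rw [coeff_neg, hfα, neg_zero])

/-- The degree `e` piece of the monomial ideal with set of exponents `U`. -/
def graded (k : Type) [Field k] {V : Type} (U : Set (V →₀ ℕ)) (e : ℤ) :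
    AddSubgroup (MvPolynomial V k) :=
  suppIn k {α | α ∈ U ∧ (α.degree : ℤ) = e}

variable {k : Type} [Field k] {V : Type}

theorem suppIn_mono {P Q : Set (V →₀ ℕ)} (h : P ⊆ Q) : suppIn k P ≤ suppIn k Q :=
  fun _ hf α hα => h (hf α hα)

theorem graded_mono {U U' : Set (V →₀ ℕ)} (h : U ⊆ U') (e : ℤ) :
    graded k U e ≤ graded k U' e :=
  suppIn_mono fun _ hα => ⟨h hα.1, hα.2⟩

theorem suppIn_eq_bot {P : Set (V →₀ ℕ)} (h : ∀ α, α ∉ P) : suppIn k P = ⊥ :=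
  (AddSubgroup.eq_bot_iff_forall _).2 fun f hf =>
    MvPolynomial.ext _ _ fun α => by
      rw [coeff_zero]
      exact not_not.1 fun hα => h α (hf α hα)

theorem coeff_single_add_smulX (x : V) (α : V →₀ ℕ) (f : MvPolynomial V k) :
    coeff (Finsupp.single x 1 + α) (smulX k _ x f) = coeff α f :=
  coeff_X_mul α x f

theorem exists_of_coeff_smulX_ne_zero {x : V} {β : V →₀ ℕ} {f : MvPolynomial V k}
    (h : coeff β (smulX k _ x f) ≠ 0) :
    ∃ α, β = Finsupp.single x 1 + α ∧ coeff α f ≠ 0 := by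
  classical
  have hβ : coeff β (X x * f) ≠ 0 := h
  rw [coeff_X_mul'] at hβ
  split_ifs at hβ with hx
  · refine ⟨β - Finsupp.single x 1, ?_, hβ⟩
    rw [add_tsub_cancel_of_le]
    rw [Finsupp.single_le_iff]
    exact Nat.one_le_iff_ne_zero.2 (Finsupp.mem_support_iff.1 hx)
  · exact absurd rfl hβ

theorem smulX_mem_suppIn {P Q : Set (V →₀ ℕ)} {x : V}
    (h : ∀ α ∈ P, Finsupp.single x 1 + α ∈ Q) {f : MvPolynomial V k} (hf : f ∈ suppIn k P) :
    smulX k _ x f ∈ suppIn k Q := fun β hβ => by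
  obtain ⟨α, rfl, hα⟩ := exists_of_coeff_smulX_ne_zero hβ
  exact h α (hf α hα)

theorem coeff_of_smulX_mem_suppIn {Q : Set (V →₀ ℕ)} {x : V} {f : MvPolynomial V k}
    (h : smulX k _ x f ∈ suppIn k Q) {α : V →₀ ℕ} (hα : coeff α f ≠ 0) :
    Finsupp.single x 1 + α ∈ Q :=
  h _ (by rwa [coeff_single_add_smulX])

theorem monomial_mem_suppIn {P : Set (V →₀ ℕ)} {α : V →₀ ℕ} (hα : α ∈ P) (c : k) :
    monomial α c ∈ suppIn k P := fun β hβ => by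
  classical
  rw [coeff_monomial] at hβ
  split_ifs at hβ with hαβ
  · exact hαβ ▸ hα
  · exact absurd rfl hβ

theorem suppIn_decomp {P A B : Set (V →₀ ℕ)} {x : V}
    (h : ∀ α ∈ P, α ∈ A ∨ ∃ β ∈ B, α = Finsupp.single x 1 + β) {f : MvPolynomial V k}
    (hf : f ∈ suppIn k P) :
    ∃ a ∈ suppIn k A, ∃ b ∈ suppIn k B, f = a + smulX k _ x b := by
  let D : AddSubgroup (MvPolynomial V k) := suppIn k A ⊔ (suppIn k B).map (smulX k _ x)
  have hD : f ∈ D := by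
    rw [f.as_sum]
    refine sum_mem fun α hα => ?_
    obtain hA | ⟨β, hβ, rfl⟩ := h α (hf α (mem_support_iff.1 hα))
    · exact AddSubgroup.mem_sup_left (monomial_mem_suppIn hA _)
    · refine AddSubgroup.mem_sup_right ⟨monomial β (coeff (Finsupp.single x 1 + β) f),
        monomial_mem_suppIn hβ _, ?_⟩
      change X x * _ = _
      rw [X, monomial_mul, one_mul]
  obtain ⟨a, ha, _, ⟨b, hb, rfl⟩, hab⟩ := AddSubgroup.mem_sup.1 hD
  exact ⟨a, ha, b, hb, hab.symm⟩

theorem degree_single_add (x : V) (α : V →₀ ℕ) :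
    ((Finsupp.single x 1 + α).degree : ℤ) = α.degree + 1 := by
  rw [map_add, Finsupp.degree_single]
  push_cast
  ring

theorem smulX_mem_graded {U : Set (V →₀ ℕ)} (hU : IsUpperSet U) (x : V) (e : ℤ)
    (f : MvPolynomial V k) (hf : f ∈ graded k U e) : smulX k _ x f ∈ graded k U (e + 1) :=
  smulX_mem_suppIn (P := {α | α ∈ U ∧ (α.degree : ℤ) = e})
    (Q := {α | α ∈ U ∧ (α.degree : ℤ) = e + 1})
    (fun α hα => ⟨hU le_add_self hα.1, by rw [degree_single_add, hα.2]⟩) hf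

/-- The Koszul complex of the polynomial ring is exact away from bidegree `(0, 0)`; the cycle may
be taken with coefficients free of the variables in `W`. -/
theorem exact_suppIn {l : List V} (hl : l.Nodup) {W : Set V} (hlW : ∀ y, y ∈ l ∨ y ∈ W)
    (hW : ∀ y ∈ l, y ∉ W) {i e : ℤ} (hie : i ≠ 0 ∨ e ≠ 0) :
    Koszul.Exact (smulX k (MvPolynomial V k)) l
      (suppIn k {α | (∀ y ∈ W, α y = 0) ∧ (α.degree : ℤ) = e}) (graded k Set.univ (e - 1)) i := by
  induction l generalizing W with
  | nil =>
    intro c hc _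
    refine ⟨0, zero_mem _, ?_⟩
    obtain ⟨hi, hc⟩ | hc := Koszul.mem_chains_nil.1 hc
    · rw [suppIn_eq_bot] at hc
      · exact (map_zero _).trans (AddSubgroup.mem_bot.1 hc).symm
      · rintro α ⟨hα, hαe⟩
        have : α = 0 := Finsupp.ext fun y => hα y ((hlW y).resolve_left List.not_mem_nil)
        rw [this, map_zero, Nat.cast_zero] at hαe
        exact hie.elim (fun h => h hi) fun h => h hαe.symm
    · exact (map_zero _).trans hc.symm
  | cons x l ih =>
    intro c hc hdc
    obtain ⟨a, b, rfl⟩ := Koszul.exists_eq_cons c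
    obtain ⟨ha, hb⟩ := Koszul.mem_chains_cons.1 hc
    rw [Koszul.d_cons, Koszul.cons_eq_zero, neg_eq_zero] at hdc
    have hxl : x ∉ l := (List.nodup_cons.1 hl).1
    have hxW : x ∉ W := hW x List.mem_cons_self
    have hsplit : ∀ α ∈ {α : V →₀ ℕ | (∀ y ∈ W, α y = 0) ∧ (α.degree : ℤ) = e},
        α ∈ {α : V →₀ ℕ | (∀ y ∈ insert x W, α y = 0) ∧ (α.degree : ℤ) = e} ∨
        ∃ β ∈ {α : V →₀ ℕ | (∀ y ∈ W, α y = 0) ∧ (α.degree : ℤ) = e - 1},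
          α = Finsupp.single x 1 + β := by
      intro α hα
      by_cases hx : α x = 0
      · exact Or.inl ⟨fun y hy => hy.elim (fun h => h ▸ hx) (hα.1 y), hα.2⟩
      · have hle : Finsupp.single x 1 ≤ α :=
          Finsupp.single_le_iff.2 (Nat.one_le_iff_ne_zero.2 hx)
        have hadd := add_tsub_cancel_of_le hle
        refine Or.inr ⟨α - Finsupp.single x 1, ⟨fun y hy => ?_, ?_⟩, hadd.symm⟩
        · rw [Finsupp.tsub_apply, hα.1 y hy, Nat.zero_sub]
        · have := degree_single_add x (α - Finsupp.single x 1)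
          rw [hadd, hα.2] at this
          exact eq_sub_of_add_eq this.symm
    obtain ⟨a₀, ha₀, a₁, ha₁, rfl⟩ := Koszul.exists_decomp (φ := smulX k _ x)
      (fun m hm => suppIn_decomp hsplit hm) ha
    have hcomm : ∀ y ∈ l, ∀ m, smulX k _ x (smulX k (MvPolynomial V k) y m) =
        smulX k _ y (smulX k _ x m) := fun y _ m => smulX_comm k x y m
    rw [map_add, Koszul.d_map hcomm, add_assoc, ← map_add, add_comm _ b] at hdc
    have hb' : b + Koszul.d (smulX k _) l a₁ ∈
        Koszul.chains (suppIn k (Set.univ : Set (V →₀ ℕ))) l (i - 1) :=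
      Koszul.chains_mono (suppIn_mono (Set.subset_univ _)) <|
        add_mem (Koszul.chains_mono (suppIn_mono (Set.subset_univ _)) hb)
          (Koszul.d_mem_chains (A := suppIn k Set.univ) (B := suppIn k Set.univ)
            (fun y m hm => smulX_mem_suppIn (fun _ _ => Set.mem_univ _) hm)
            (Koszul.chains_mono (suppIn_mono (Set.subset_univ _)) ha₁))
    have hda₀ : Koszul.d (smulX k _) l a₀ ∈
        Koszul.chains (suppIn k {α : V →₀ ℕ | α x = 0}) l (i - 1) := by
      refine Koszul.d_mem_chains_of_mem (fun y hy m hm => smulX_mem_suppIn (fun α hα => ?_) hm)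
        (Koszul.chains_mono (suppIn_mono (Q := {α | α x = 0})
          fun α hα => hα.1 x (Set.mem_insert x W)) ha₀)
      have : y ≠ x := fun h => hxl (h ▸ hy)
      simpa [this] using hα
    have hb0 : b + Koszul.d (smulX k _) l a₁ = 0 := by
      refine Koszul.eq_zero_of_eq_bot (A := ⊥) rfl
        (Koszul.mem_chains_of_map (φ := smulX k _ x)
          (B := suppIn k {α : V →₀ ℕ | α x = 0}) (fun m _ hm => ?_) hb' ?_)
      · refine AddSubgroup.mem_bot.2 (MvPolynomial.ext _ _ fun α => ?_)
        rw [coeff_zero]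
        by_contra hα
        have := coeff_of_smulX_mem_suppIn hm hα
        simp at this
      · rw [← neg_eq_of_add_eq_zero_right hdc.1]
        exact neg_mem hda₀
    rw [hb0, map_zero, add_zero] at hdc
    obtain ⟨f, hf, hdf⟩ := ih (List.nodup_cons.1 hl).2 (W := insert x W)
      (fun y => by
        obtain h | h := hlW y
        · obtain rfl | h := List.mem_cons.1 h
          · exact Or.inr (Set.mem_insert _ _)
          · exact Or.inl h
        · exact Or.inr (Set.mem_insert_of_mem _ h))
      (fun y hy hyW => hyW.elim (fun h => hxl (h ▸ hy)) (hW y (List.mem_cons_of_mem _ hy)))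
      a₀ ha₀ hdc.1
    refine ⟨Koszul.cons x f a₁, ⟨hf, ?_⟩, ?_⟩
    · rw [add_sub_cancel_right]
      exact Koszul.chains_mono (suppIn_mono
        (Q := {α | α ∈ Set.univ ∧ (α.degree : ℤ) = e - 1})
        fun α hα => ⟨Set.mem_univ _, hα.2⟩) ha₁
    · rw [Koszul.d_cons, hdf, neg_eq_of_add_eq_zero_left hb0]

/-- `l` enumerates the variables without repetition. -/
structure Enumerates (l : List V) : Prop where
  nodup : l.Nodup
  mem : ∀ x, x ∈ l

variable {l : List V}

theorem exact_graded_univ (hl : Enumerates l) {i e : ℤ} (hie : i ≠ 0 ∨ e ≠ 0) :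
    Koszul.Exact (smulX k (MvPolynomial V k)) l (graded k Set.univ e)
      (graded k Set.univ (e - 1)) i := by
  have := exact_suppIn (k := k) hl.nodup (W := ∅) (fun y => Or.inl (hl.mem y))
    (fun y _ h => h) hie
  simpa [graded] using this

/-! ### Regularity bounds for monomial ideals -/

/-- The Koszul homology of the monomial ideal with set of exponents `U` vanishes in internal
degrees above `t`, i.e. the ideal has regularity at most `t`. -/
def RegLE (k : Type) [Field k] (l : List V) (U : Set (V →₀ ℕ)) (t : ℕ) : Prop :=
  ∀ i e : ℤ, (t : ℤ) < e →
    Koszul.Exact (smulX k (MvPolynomial V k)) l (graded k U e) (graded k U (e - 1)) i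

theorem RegLE.mono {U : Set (V →₀ ℕ)} {t t' : ℕ} (h : RegLE k l U t) (ht : t ≤ t') :
    RegLE k l U t' := fun i e he => h i e (by omega)

theorem graded_addVar_decomp {U : Set (V →₀ ℕ)} {x : V} (e : ℤ) (f : MvPolynomial V k)
    (hf : f ∈ graded k (U ∪ {α | α x ≠ 0}) (e + 1)) :
    ∃ a ∈ graded k U (e + 1), ∃ b ∈ graded k Set.univ e, f = a + smulX k _ x b := by
  refine suppIn_decomp (fun α hα => ?_) hf
  by_cases hU : α ∈ U
  · exact Or.inl ⟨hU, hα.2⟩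
  · have hle : Finsupp.single x 1 ≤ α :=
      Finsupp.single_le_iff.2 (Nat.one_le_iff_ne_zero.2 (hα.1.resolve_left hU))
    have hadd := add_tsub_cancel_of_le hle
    have hdeg := degree_single_add x (α - Finsupp.single x 1)
    rw [hadd, hα.2] at hdeg
    exact Or.inr ⟨_, ⟨Set.mem_univ _, (add_right_cancel hdeg).symm⟩, hadd.symm⟩

theorem mem_graded_colon {U : Set (V →₀ ℕ)} {x : V} (e : ℤ) (f : MvPolynomial V k)
    (hf : f ∈ graded k Set.univ e) (hxf : smulX k _ x f ∈ graded k U (e + 1)) :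
    f ∈ graded k {α | Finsupp.single x 1 + α ∈ U} e :=
  fun α hα => ⟨(coeff_of_smulX_mem_suppIn hxf hα).1, (hf α hα).2⟩

theorem smulX_mem_of_mem_colon {U : Set (V →₀ ℕ)} {x : V} (e : ℤ) (f : MvPolynomial V k)
    (hf : f ∈ graded k {α | Finsupp.single x 1 + α ∈ U} e) :
    smulX k _ x f ∈ graded k U (e + 1) :=
  smulX_mem_suppIn (P := {α | Finsupp.single x 1 + α ∈ U ∧ (α.degree : ℤ) = e})
    (Q := {α | α ∈ U ∧ (α.degree : ℤ) = e + 1})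
    (fun α hα => ⟨hα.1, by rw [degree_single_add, hα.2]⟩) hf

/-- `reg I ≤ max (reg (I : x) + 1) (reg (I, x))`. -/
theorem RegLE.of_colon {U : Set (V →₀ ℕ)} (hU : IsUpperSet U) {x : V} {t : ℕ}
    (h₁ : RegLE k l {α | Finsupp.single x 1 + α ∈ U} t)
    (h₂ : RegLE k l (U ∪ {α | α x ≠ 0}) (t + 1)) : RegLE k l U (t + 1) := by
  intro i e he
  have := Koszul.Exact.of_colon (l := l) (i := i) (e := e - 1) (φ := smulX k _ x)
    (I := graded k U) (J := graded k {α | Finsupp.single x 1 + α ∈ U})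
    (C := graded k (U ∪ {α | α x ≠ 0})) (S := graded k Set.univ) (smulX_comm k)
    (fun y m => smulX_comm k x y m)
    (smulX_mem_graded hU) (smulX_mem_graded isUpperSet_univ)
    (graded_mono fun α hα => Or.inl hα)
    graded_addVar_decomp mem_graded_colon smulX_mem_of_mem_colon
    (h₁ i _ (by push_cast at he; omega))
    (by rw [sub_add_cancel]; exact h₂ i e he)
  rwa [sub_add_cancel] at this

/-- Ideals generated by variables have regularity at most `1`. -/
theorem regLE_variables (hl : Enumerates l) (Z : Finset V) :
    RegLE k l {α | ∃ z ∈ Z, α z ≠ 0} 1 := by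
  classical
  induction Z using Finset.induction_on with
  | empty =>
    intro i e _ c hc _
    refine ⟨0, zero_mem _, ?_⟩
    rw [map_zero, Koszul.eq_zero_of_eq_bot (suppIn_eq_bot fun α hα => ?_) hc]
    simp at hα
  | insert z Z hz ih =>
    have hU (Z : Finset V) : IsUpperSet {α : V →₀ ℕ | ∃ z ∈ Z, α z ≠ 0} :=
      fun α β hαβ ⟨y, hy, hα⟩ => ⟨y, hy, by have := hαβ y; omega⟩
    have hunion : {α : V →₀ ℕ | ∃ y ∈ insert z Z, α y ≠ 0} =
        {α | ∃ y ∈ Z, α y ≠ 0} ∪ {α | α z ≠ 0} := by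
      ext α
      simp [or_comm]
    have hcolon : {α : V →₀ ℕ | Finsupp.single z 1 + α ∈ {α : V →₀ ℕ | ∃ y ∈ Z, α y ≠ 0}} =
        {α | ∃ y ∈ Z, α y ≠ 0} := by
      ext α
      refine exists_congr fun y => and_congr_right fun hy => ?_
      have : z ≠ y := fun h => hz (h ▸ hy)
      simp [this]
    intro i e he
    rw [hunion]
    have := Koszul.Exact.of_add (l := l) (i := i) (e := e - 1) (φ := smulX k _ z)
      (I := graded k {α : V →₀ ℕ | ∃ y ∈ Z, α y ≠ 0})
      (J := graded k {α : V →₀ ℕ | Finsupp.single z 1 + α ∈ {α : V →₀ ℕ | ∃ y ∈ Z, α y ≠ 0}})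
      (C := graded k ({α : V →₀ ℕ | ∃ y ∈ Z, α y ≠ 0} ∪ {α | α z ≠ 0}))
      (S := graded k Set.univ) (smulX_comm k) (fun y m => smulX_comm k z y m)
      (smulX_mem_graded isUpperSet_univ)
      (graded_mono fun α hα => Or.inl hα)
      (smulX_mem_graded (hU Z))
      (graded_mono (Set.subset_univ _))
      graded_addVar_decomp
      (fun e f hf => graded_mono (fun α hα => Or.inr hα) _
        (smulX_mem_suppIn (P := {α | α ∈ Set.univ ∧ (α.degree : ℤ) = e})
          (Q := {α | α z ≠ 0 ∧ (α.degree : ℤ) = e + 1})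
          (fun α hα => ⟨by simp, by rw [degree_single_add, hα.2]⟩) hf))
      mem_graded_colon smulX_mem_of_mem_colon
      (by rw [sub_add_cancel]; exact ih i e he)
      (exact_graded_univ hl (Or.inr (by push_cast at he; omega)))
      (by rw [sub_add_cancel, hcolon]; exact ih (i - 1) e he)
    rwa [sub_add_cancel] at this

end WOG

namespace WOG

variable {k : Type} [Field k] {V : Type} {l : List V}

/-! ### The upper bound: adding and dividing by variables, one part at a time -/

/-- The exponents of the multiples of some `y ^ p y` with `p y ≠ 0`. -/
def powerSet (p : V → ℕ) : Set (V →₀ ℕ) := {α | ∃ y, p y ≠ 0 ∧ p y ≤ α y}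

/-- The exponents of the multiples of some `x * y ^ w y`, where `x` lies in a part of index at
least `s` and `y` lies in the next one. -/
def edgeSet (part w : V → ℕ) (s : ℕ) : Set (V →₀ ℕ) :=
  {α | ∃ x y, part y = part x + 1 ∧ s ≤ part x ∧ α x ≠ 0 ∧ w y ≤ α y}

theorem isUpperSet_powerSet (p : V → ℕ) : IsUpperSet (powerSet p) :=
  fun _ _ h ⟨y, hy, hα⟩ => ⟨y, hy, hα.trans (h y)⟩

theorem isUpperSet_edgeSet (part w : V → ℕ) (s : ℕ) : IsUpperSet (edgeSet part w s) :=
  fun _ _ h ⟨x, y, hxy, hs, hx, hy⟩ =>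
    ⟨x, y, hxy, hs, fun h0 => hx (Nat.le_zero.1 (h0 ▸ h x)), hy.trans (h y)⟩

theorem single_add_apply_of_ne {x y : V} (h : y ≠ x) (α : V →₀ ℕ) :
    (Finsupp.single x 1 + α : V →₀ ℕ) y = α y := by
  rw [Finsupp.add_apply, Finsupp.single_eq_of_ne h, zero_add]

theorem single_add_apply_same (x : V) (α : V →₀ ℕ) :
    (Finsupp.single x 1 + α : V →₀ ℕ) x = α x + 1 := by
  rw [Finsupp.add_apply, Finsupp.single_eq_same, add_comm]

theorem mem_powerSet_union [DecidableEq V] (p : V → ℕ) (x : V) :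
    powerSet p ∪ {α | α x ≠ 0} = powerSet (Function.update p x 1) := by
  ext α
  constructor
  · rintro (⟨y, hy, hα⟩ | hα)
    · by_cases hyx : y = x
      · subst hyx
        exact ⟨y, by simp, by rw [Function.update_self]; omega⟩
      · exact ⟨y, by rwa [Function.update_of_ne hyx], by rwa [Function.update_of_ne hyx]⟩
    · exact ⟨x, by simp, by rw [Function.update_self]; exact Nat.one_le_iff_ne_zero.2 hα⟩
  · rintro ⟨y, hy, hα⟩
    by_cases hyx : y = x
    · subst hyx
      rw [Function.update_self] at hα
      exact Or.inr (Nat.one_le_iff_ne_zero.1 hα)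
    · rw [Function.update_of_ne hyx] at hy hα
      exact Or.inl ⟨y, hy, hα⟩

theorem powerSet_colon [DecidableEq V] {p : V → ℕ} {x : V} (hx : p x ≠ 1) :
    {α | Finsupp.single x 1 + α ∈ powerSet p} = powerSet (Function.update p x (p x - 1)) := by
  ext α
  refine exists_congr fun y => ?_
  by_cases hyx : y = x
  · subst hyx
    rw [Function.update_self, single_add_apply_same]
    omega
  · rw [Function.update_of_ne hyx, single_add_apply_of_ne hyx]

variable [Fintype V]

theorem regLE_powerSet (hl : Enumerates l) (p : V → ℕ) :
    RegLE k l (powerSet p) (1 + ∑ y, (p y - 1)) := by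
  classical
  induction hN : ∑ y, (p y - 1) using Nat.strong_induction_on generalizing p with
  | h N ih =>
    by_cases hp : ∃ x, 2 ≤ p x
    · obtain ⟨x, hx⟩ := hp
      have hlt (q : ℕ) (hq : q < p x) (hq' : q - 1 < p x - 1) :
          ∑ y, (Function.update p x q y - 1) < N := by
        rw [← hN]
        refine Finset.sum_lt_sum (fun y _ => ?_) ⟨x, Finset.mem_univ x, ?_⟩
        · by_cases hyx : y = x
          · subst hyx
            rw [Function.update_self]
            exact hq'.le
          · rw [Function.update_of_ne hyx]
        · rwa [Function.update_self]
      have h₁ := hlt (p x - 1) (by omega) (by omega)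
      have h₂ := hlt 1 (by omega) (by omega)
      have := RegLE.of_colon (k := k) (l := l) (t := N) (isUpperSet_powerSet p) (x := x)
        (by
          rw [powerSet_colon (by omega)]
          exact (ih _ h₁ _ rfl).mono (by omega))
        (by
          rw [mem_powerSet_union]
          exact (ih _ h₂ _ rfl).mono (by omega))
      rwa [add_comm] at this
    · push Not at hp
      have hZ : powerSet p = {α | ∃ z ∈ Finset.univ.filter (p · = 1), α z ≠ 0} := by
        ext α
        refine exists_congr fun y => ?_
        have := hp y
        simp only [Finset.mem_filter, Finset.mem_univ, true_and]
        omega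
      rw [hZ]
      exact (regLE_variables hl _).mono (by omega)

/-- The contribution of the vertex `y` to the regularity bound at stage `s`. -/
def stageCost (part w : V → ℕ) (s : ℕ) (p : V → ℕ) (y : V) : ℕ :=
  (p y - 1) + if s < part y then w y - 1 else 0

theorem regLE_stage (hl : Enumerates l) {part w : V → ℕ} {m : ℕ} (hlt : ∀ x, part x < m)
    (hne : ∀ i < m, ∃ x, part x = i) (hw : ∀ x, 1 ≤ w x)
    (hw2 : ∀ x, part x ≠ 0 → part x ≠ m - 1 → 2 ≤ w x) (n s : ℕ) (hs : s + n + 1 = m)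
    (p : V → ℕ) (hp : ∀ y, s < part y → p y = 0) (t : ℕ)
    (ht : 1 + ∑ y, stageCost part w s p y ≤ t)
    (ht' : s + 1 < m → (∃ x, part x = s ∧ p x = 0) → 2 + ∑ y, stageCost part w s p y ≤ t) :
    RegLE k l (powerSet p ∪ edgeSet part w s) t := by
  classical
  induction n generalizing s p t with
  | zero =>
    have hE : edgeSet part w s = ∅ := by
      refine Set.eq_empty_iff_forall_notMem.2 fun α ⟨x, y, hxy, hsx, _⟩ => ?_
      have := hlt y
      omega
    rw [hE, Set.union_empty]
    refine (regLE_powerSet hl p).mono (le_trans ?_ ht)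
    exact Nat.add_le_add_left (Finset.sum_le_sum fun y _ => Nat.le_add_right _ _) 1
  | succ n ih =>
    induction hN : (Finset.univ.filter fun x => part x = s ∧ p x ≠ 1).card
      using Nat.strong_induction_on generalizing p with
    | h N ihN =>
    by_cases hx : ∃ x, part x = s ∧ p x ≠ 1
    · obtain ⟨x, hxs, hx1⟩ := hx
      obtain ⟨t, rfl⟩ : ∃ t', t = t' + 1 := ⟨t - 1, by omega⟩
      refine RegLE.of_colon ((isUpperSet_powerSet p).union (isUpperSet_edgeSet part w s))
        (x := x) ?_ ?_
      · let q : V → ℕ := fun y =>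
          if y = x then p x - 1 else if part y = s + 1 then w y else p y
        have hqx : q x = p x - 1 := if_pos rfl
        have hq1 (y : V) (hy : part y = s + 1) : q y = w y :=
          (if_neg (by rintro rfl; omega)).trans (if_pos hy)
        have hq (y : V) (hyx : y ≠ x) (hy : part y ≠ s + 1) : q y = p y :=
          (if_neg hyx).trans (if_neg hy)
        have hcolon : {α | Finsupp.single x 1 + α ∈ powerSet p ∪ edgeSet part w s} =
            powerSet q ∪ edgeSet part w (s + 1) := by
          ext α
          constructor
          · rintro (⟨y, hy, hα⟩ | ⟨y, z, hyz, hsy, hy, hz⟩)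
            · by_cases hyx : y = x
              · subst hyx
                rw [single_add_apply_same] at hα
                exact Or.inl ⟨y, by omega, by omega⟩
              · rw [single_add_apply_of_ne hyx] at hα
                have hqy := hq y hyx fun h => hy (hp y (by omega))
                exact Or.inl ⟨y, by rwa [hqy], by rwa [hqy]⟩
            · have hzx : z ≠ x := by rintro rfl; omega
              rw [single_add_apply_of_ne hzx] at hz
              obtain hsy | hsy := hsy.eq_or_lt
              · have hqz := hq1 z (by omega)
                have := hw z
                exact Or.inl ⟨z, by omega, by omega⟩
              · have hyx : y ≠ x := by rintro rfl; omega
                rw [single_add_apply_of_ne hyx] at hy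
                exact Or.inr ⟨y, z, hyz, hsy, hy, hz⟩
          · rintro (⟨y, hy, hα⟩ | ⟨y, z, hyz, hsy, hy, hz⟩)
            · by_cases hyx : y = x
              · subst hyx
                exact Or.inl ⟨y, by omega, by rw [single_add_apply_same]; omega⟩
              · by_cases hys : part y = s + 1
                · refine Or.inr ⟨x, y, by omega, hxs.ge, ?_, ?_⟩
                  · rw [single_add_apply_same]
                    omega
                  · rw [single_add_apply_of_ne hyx, ← hq1 y hys]
                    exact hα
                · rw [hq y hyx hys] at hy hα
                  exact Or.inl ⟨y, hy, by rwa [single_add_apply_of_ne hyx]⟩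
            · exact isUpperSet_edgeSet part w s le_add_self
                |> fun h => Or.inr (h ⟨y, z, hyz, by omega, hy, hz⟩)
        rw [hcolon]
        have hcost (y : V) (hyx : y ≠ x) :
            stageCost part w (s + 1) q y = stageCost part w s p y := by
          by_cases hys : part y = s + 1
          · rw [stageCost, stageCost, hq1 y hys, hp y (by omega), hys]
            simp
          · rw [stageCost, stageCost, hq y hyx hys]
            congr 1
            split_ifs <;> first | rfl | omega
        have hcostx : stageCost part w (s + 1) q x = p x - 1 - 1 := by
          rw [stageCost, hqx, if_neg (by omega), add_zero]
        have hcostx' : stageCost part w s p x = p x - 1 := by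
          rw [stageCost, if_neg (by omega), add_zero]
        refine ih (s + 1) (by omega) q (fun y hy => ?_) t ?_ fun _ ⟨y, hy, hqy⟩ => ?_
        · rw [hq y (by rintro rfl; omega) (by omega)]
          exact hp y (by omega)
        · have hS : stageCost part w s p x + ∑ y ∈ Finset.univ.erase x, stageCost part w s p y =
              ∑ y, stageCost part w s p y := Finset.add_sum_erase _ _ (Finset.mem_univ x)
          have hS' : stageCost part w (s + 1) q x +
              ∑ y ∈ Finset.univ.erase x, stageCost part w s p y =
              ∑ y, stageCost part w (s + 1) q y := by
            rw [← Finset.add_sum_erase _ _ (Finset.mem_univ x)]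
            exact congrArg _
              (Finset.sum_congr rfl fun y hy => (hcost y (Finset.ne_of_mem_erase hy)).symm)
          by_cases hx0 : p x = 0
          · have := ht' (by omega) ⟨x, hxs, hx0⟩
            omega
          · omega
        · have := hw y
          rw [hq1 y hy] at hqy
          omega
      · rw [Set.union_right_comm, mem_powerSet_union]
        have hcost : ∑ y, stageCost part w s (Function.update p x 1) y ≤
            ∑ y, stageCost part w s p y := by
          refine Finset.sum_le_sum fun y _ => Nat.add_le_add_right ?_ _
          by_cases hyx : y = x
          · rw [hyx, Function.update_self]
            exact Nat.zero_le _
          · rw [Function.update_of_ne hyx]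
        refine ihN _ ?_ (Function.update p x 1) (fun y hy => ?_) (by omega) ?_ rfl
        · rw [← hN]
          refine Finset.card_lt_card ((Finset.ssubset_iff_of_subset fun y hy => ?_).2 ⟨x, ?_, ?_⟩)
          · simp only [Finset.mem_filter, Finset.mem_univ, true_and] at hy ⊢
            have hyx : y ≠ x := by
              rintro rfl
              exact hy.2 (Function.update_self ..)
            rwa [Function.update_of_ne hyx] at hy
          · simp [hxs, hx1]
          · simp
        · rw [Function.update_of_ne (by rintro rfl; omega)]
          exact hp y hy
        · rintro hsm ⟨y, hy, hy0⟩
          have hyx : y ≠ x := by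
            rintro rfl
            simp at hy0
          rw [Function.update_of_ne hyx] at hy0
          have := ht' hsm ⟨y, hy, hy0⟩
          omega
    · push Not at hx
      have hset : powerSet p ∪ edgeSet part w s = powerSet p ∪ edgeSet part w (s + 1) := by
        ext α
        constructor
        · rintro (hα | ⟨y, z, hyz, hsy, hy, hz⟩)
          · exact Or.inl hα
          · obtain hsy | hsy := hsy.eq_or_lt
            · have := hx y hsy.symm
              exact Or.inl ⟨y, by omega, by omega⟩
            · exact Or.inr ⟨y, z, hyz, hsy, hy, hz⟩
        · rintro (hα | ⟨y, z, hyz, hsy, hy, hz⟩)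
          · exact Or.inl hα
          · exact Or.inr ⟨y, z, hyz, by omega, hy, hz⟩
      have hcost (y : V) : stageCost part w (s + 1) p y ≤ stageCost part w s p y := by
        refine Nat.add_le_add_left ?_ _
        split_ifs <;> omega
      rw [hset]
      refine ih (s + 1) (by omega) p (fun y hy => hp y (by omega)) t
        (le_trans (Nat.add_le_add_left (Finset.sum_le_sum fun y _ => hcost y) 1) ht) ?_
      intro hsm _
      obtain ⟨y, hy⟩ := hne (s + 1) (by omega)
      have hwy := hw2 y (by omega) (by omega)
      have : ∑ y, stageCost part w (s + 1) p y < ∑ y, stageCost part w s p y := by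
        refine Finset.sum_lt_sum (fun y _ => hcost y) ⟨y, Finset.mem_univ y, ?_⟩
        rw [stageCost, stageCost, if_neg (by omega), if_pos (by omega)]
        omega
      omega

end WOG

namespace WOG

variable {k : Type} [Field k] {V : Type}

/-! ### Nonvanishing of Koszul homology -/

theorem not_exact_graded {U : Set (V →₀ ℕ)} {l' l : List V} (hl : Enumerates (l' ++ l))
    {ω : V →₀ ℕ}
    (hU : ∀ y ∈ l', ∀ x ∈ l, Finsupp.single y 1 + (Finsupp.single x 1 + ω) ∈ U)
    {x y : V} (hx : x ∈ l) (hxU : Finsupp.single x 1 + ω ∉ U)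
    (hy : y ∈ l') (hyU : Finsupp.single y 1 + ω ∉ U) :
    ¬ Koszul.Exact (smulX k (MvPolynomial V k)) (l' ++ l) (graded k U (ω.degree + 2))
      (graded k U (ω.degree + 1)) ((l' ++ l).length - 2) := by
  classical
  intro h
  let v : MvPolynomial V k := monomial ω 1
  let T := smulX (V := V) k (MvPolynomial V k)
  let P : Set (V →₀ ℕ) := {α | ∃ x ∈ l, α = Finsupp.single x 1 + ω}
  have hv : v ∈ suppIn k {ω} := monomial_mem_suppIn (Set.mem_singleton ω) 1
  have hu : Koszul.d T l (Koszul.top l v) ∈ Koszul.chains (suppIn k P) l (l.length - 1) :=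
    Koszul.d_mem_chains_of_mem (A := suppIn k {ω})
      (fun x hx m hm => smulX_mem_suppIn (P := {ω}) (Q := P)
        (fun α hα => ⟨x, hx, by rw [hα]⟩) hm)
      (Koszul.top_mem_chains hv)
  have hdu := Koszul.d_topExt_mem_chains (l' := l') (B := graded k U (ω.degree + 2)) hu
    (Koszul.d_d (smulX_comm k) l _)
    fun y hy m hm => smulX_mem_suppIn (P := P) (by
      rintro _ ⟨x, hx, rfl⟩
      refine ⟨hU y hy x hx, ?_⟩
      rw [degree_single_add, degree_single_add, add_assoc]
      rfl) hm
  have hlen : ((l' ++ l).length : ℤ) = l'.length + l.length := by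
    rw [List.length_append, Nat.cast_add]
  have hu' := Koszul.topExt_mem_chains hu l'
  obtain ⟨c, hc, hdc⟩ := h _
    (by convert hdu using 2; rw [hlen]; ring) (Koszul.d_d (smulX_comm k) _ _)
  have hpos : 0 < l.length ∧ 0 < l'.length :=
    ⟨List.length_pos_of_mem hx, List.length_pos_of_mem hy⟩
  rw [show ((l' ++ l).length : ℤ) - 2 + 1 = (l' ++ l).length - 1 by ring] at hc
  rw [show (l.length : ℤ) - 1 + l'.length = (l' ++ l).length - 1 by rw [hlen]; ring] at hu'
  have hPd : suppIn k P ≤ graded k Set.univ (ω.degree + 1) := by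
    refine suppIn_mono ?_
    rintro _ ⟨x, -, rfl⟩
    exact ⟨Set.mem_univ _, degree_single_add x ω⟩
  obtain ⟨f, hf, hdf⟩ := exact_graded_univ hl
    (i := (l' ++ l).length - 1) (e := ω.degree + 1) (Or.inl (by omega)) _
    (sub_mem (Koszul.chains_mono hPd hu')
      (Koszul.chains_mono (graded_mono (Set.subset_univ U) _) hc))
    (by rw [map_sub, hdc, sub_self])
  rw [sub_add_cancel] at hf
  obtain ⟨β, -, rfl⟩ := Koszul.exists_eq_top hf
  obtain ⟨h₁, h₂⟩ := Koszul.mem_of_topExt_sub_mem_chains (v := v)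
    (A := graded k U (ω.degree + 1)) (by rwa [hdf, sub_sub_cancel])
  have hβ : coeff ω β = 0 := by
    by_contra hβ
    exact hyU (coeff_of_smulX_mem_suppIn (h₁ y hy) hβ).1
  have hω : coeff ω v = 1 := by simp [v]
  obtain h₂ | h₂ := h₂
  · exact hxU (coeff_of_smulX_mem_suppIn (h₂ x hx) (by simp [hω, hβ])).1
  · exact hxU (coeff_of_smulX_mem_suppIn (h₂ x hx) (by simp [hω, hβ])).1

end WOG

namespace WOG

variable {k : Type} [Field k] {V : Type} {l : List V}

/-! ### Koszul homology of graded free modules -/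

section Free

variable {ι : Type}

/-- The elements of the graded free module with basis in degrees `dg` all of whose homogeneous
components have degree in `P`. -/
def freePiece (k V : Type) [Field k] {ι : Type} (dg : ι → ℕ) (P : Set ℤ) :
    AddSubgroup (ι →₀ MvPolynomial V k) where
  carrier := {f | ∀ a, f a ∈ suppIn k {α | (α.degree : ℤ) + dg a ∈ P}}
  zero_mem' := fun _ => zero_mem _
  add_mem' := fun hf hg a => add_mem (hf a) (hg a)
  neg_mem' := fun hf a => neg_mem (hf a)

/-- The degree `e` piece of the kernel of `φ`. -/
def kerPiece (dg : ι → ℕ) {N : Type} [AddCommGroup N] [Module (MvPolynomial V k) N]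
    (φ : (ι →₀ MvPolynomial V k) →ₗ[MvPolynomial V k] N) (e : ℤ) :
    AddSubgroup (ι →₀ MvPolynomial V k) :=
  freePiece k V dg {e} ⊓ φ.toAddMonoidHom.ker

variable {dg : ι → ℕ}

theorem smulX_mem_freePiece (x : V) (e : ℤ) (f : ι →₀ MvPolynomial V k)
    (hf : f ∈ freePiece k V dg {e}) : smulX k _ x f ∈ freePiece k V dg {e + 1} := fun a =>
  smulX_mem_suppIn (fun α (hα : (α.degree : ℤ) + dg a = e) =>
    show ((Finsupp.single x 1 + α).degree : ℤ) + dg a = e + 1 by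
      rw [degree_single_add, ← hα]; ring) (hf a)

theorem suppIn_inter_eq_zero {P Q : Set (V →₀ ℕ)} (h : Disjoint P Q) {f : MvPolynomial V k}
    (hP : f ∈ suppIn k P) (hQ : f ∈ suppIn k Q) : f = 0 :=
  MvPolynomial.ext _ _ fun α => not_not.1 fun hα =>
    Set.disjoint_left.1 h (hP α hα) (hQ α hα)

theorem exists_suppIn_add (P : Set (V →₀ ℕ)) (f : MvPolynomial V k) :
    ∃ g ∈ suppIn k P, ∃ h ∈ suppIn k Pᶜ, f = g + h := by
  have hf : f ∈ suppIn k P ⊔ suppIn k Pᶜ := by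
    rw [f.as_sum]
    refine sum_mem fun α _ => ?_
    by_cases hα : α ∈ P
    · exact AddSubgroup.mem_sup_left (monomial_mem_suppIn hα _)
    · exact AddSubgroup.mem_sup_right (monomial_mem_suppIn hα _)
  obtain ⟨g, hg, h, hh, hgh⟩ := AddSubgroup.mem_sup.1 hf
  exact ⟨g, hg, h, hh, hgh.symm⟩

theorem exists_freePiece_add [Finite ι] (P : Set ℤ) (f : ι →₀ MvPolynomial V k) :
    ∃ g ∈ freePiece k V dg P, ∃ h ∈ freePiece k V dg Pᶜ, f = g + h := by
  choose g hg h hh hf using fun a =>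
    exists_suppIn_add {α : V →₀ ℕ | (α.degree : ℤ) + dg a ∈ P} (f a)
  exact ⟨Finsupp.equivFunOnFinite.symm g, hg, Finsupp.equivFunOnFinite.symm h, hh,
    Finsupp.ext hf⟩

theorem freePiece_inter_eq_zero {P : Set ℤ} {f : ι →₀ MvPolynomial V k}
    (h : f ∈ freePiece k V dg P) (h' : f ∈ freePiece k V dg Pᶜ) : f = 0 :=
  Finsupp.ext fun a => suppIn_inter_eq_zero
    disjoint_compl_right (h a) (h' a)

theorem isHomogeneous_mul_mem {P : Set ℤ} {c n e : ℕ} (hce : n = c + e)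
    {f g : MvPolynomial V k} (hf : f ∈ suppIn k {α | (α.degree : ℤ) + n ∈ P})
    (hg : g.IsHomogeneous e) : f * g ∈ suppIn k {α | (α.degree : ℤ) + c ∈ P} := by
  classical
  intro α hα
  rw [coeff_mul] at hα
  obtain ⟨⟨β, γ⟩, hβγ, hne⟩ := Finset.exists_ne_zero_of_sum_ne_zero hα
  have hβ := hf β (left_ne_zero_of_mul hne)
  have hγ : γ.degree = e := by
    rw [← hg (right_ne_zero_of_mul hne), Finsupp.degree_eq_weight_one]
    rfl
  rw [← Finset.HasAntidiagonal.mem_antidiagonal.1 hβγ]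
  change ((β + γ).degree : ℤ) + c ∈ P
  convert (show (β.degree : ℤ) + n ∈ P from hβ) using 1
  rw [map_add, hγ, hce]
  push_cast
  ring

theorem linearMap_apply_eq_sum {N : Type} [AddCommGroup N] [Module (MvPolynomial V k) N]
    (φ : (ι →₀ MvPolynomial V k) →ₗ[MvPolynomial V k] N) (f : ι →₀ MvPolynomial V k) :
    φ f = f.sum fun a s => s • φ (Finsupp.single a 1) := by
  conv_lhs => rw [← Finsupp.sum_single f, map_finsuppSum]
  refine Finsupp.sum_congr fun a _ => ?_
  rw [← map_smul, Finsupp.smul_single_one]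

theorem linearMap_apply_mem_suppIn {P : Set ℤ} {c : ℕ}
    {φ : (ι →₀ MvPolynomial V k) →ₗ[MvPolynomial V k] MvPolynomial V k}
    (hφ : ∀ a, φ (Finsupp.single a 1) = 0 ∨
      ∃ e, dg a = c + e ∧ (φ (Finsupp.single a 1)).IsHomogeneous e)
    {f : ι →₀ MvPolynomial V k} (hf : f ∈ freePiece k V dg P) :
    φ f ∈ suppIn k {α | (α.degree : ℤ) + c ∈ P} := by
  rw [linearMap_apply_eq_sum]
  refine sum_mem fun a _ => ?_
  obtain h0 | ⟨e, hce, he⟩ := hφ a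
  · dsimp only
    rw [h0, smul_zero]
    exact zero_mem _
  · exact isHomogeneous_mul_mem hce (hf a) he

theorem exact_freePiece [Finite ι] (hl : Enumerates l) {A : AddSubgroup (ι →₀ MvPolynomial V k)}
    {s e : ℤ} (hA : A ≤ freePiece k V dg {e})
    (hs : s ≠ 0 ∨ ∀ f ∈ A, ∀ a, constantCoeff (f a) = 0) :
    Koszul.Exact (smulX k (ι →₀ MvPolynomial V k)) l A (freePiece k V dg {e - 1}) s := by
  classical
  have := Fintype.ofFinite ι
  intro c hc hdc
  let π (a : ι) : (ι →₀ MvPolynomial V k) →+ MvPolynomial V k := Finsupp.applyAddHom a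
  let j (a : ι) : MvPolynomial V k →+ (ι →₀ MvPolynomial V k) := Finsupp.singleAddHom a
  have hπ (a : ι) : ∀ x ∈ l, ∀ m, π a (smulX k _ x m) = smulX k _ x (π a m) := fun _ _ _ => rfl
  have hj (a : ι) : ∀ x ∈ l, ∀ m, j a (smulX k _ x m) = smulX k _ x (j a m) := fun x _ m =>
    (Finsupp.smul_single (X x : MvPolynomial V k) a m).symm
  have hdeg (a : ι) : ∀ f ∈ A, π a f ∈ graded k Set.univ (e - dg a) := fun f hf α hα =>
    ⟨Set.mem_univ _, eq_sub_of_add_eq (hA hf a α hα)⟩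
  have hex (a : ι) : ∃ b ∈ Koszul.chains (graded k Set.univ (e - dg a - 1)) l (s + 1),
      Koszul.d (smulX k _) l b = Koszul.map (π a) l c := by
    by_cases hse : s ≠ 0 ∨ e - dg a ≠ 0
    · refine exact_graded_univ hl hse _ (Koszul.map_mem_chains (hdeg a) hc) ?_
      rw [Koszul.d_map (hπ a), hdc, map_zero]
    · push Not at hse
      refine ⟨0, zero_mem _, ?_⟩
      have hz : Koszul.map (π a) l c ∈ Koszul.chains ⊥ l s :=
        Koszul.map_mem_chains (fun f hf => AddSubgroup.mem_bot.2 <|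
          MvPolynomial.ext _ _ fun α => not_not.1 fun hα => by
            have h0 := (hdeg a f hf α hα).2
            rw [hse.2, Nat.cast_eq_zero, Finsupp.degree_eq_zero_iff] at h0
            exact hα (h0 ▸ hs.resolve_left (not_not.2 hse.1) f hf a)) hc
      rw [map_zero, Koszul.eq_zero_of_eq_bot rfl hz]
  choose b hb hdb using hex
  refine ⟨∑ a, Koszul.map (j a) l (b a), sum_mem fun a _ =>
    Koszul.map_mem_chains (fun m hm a' => ?_) (hb a), ?_⟩
  · change Finsupp.single a m a' ∈ _
    by_cases haa : a' = a
    · subst haa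
      rw [Finsupp.single_eq_same]
      refine suppIn_mono ?_ hm
      rintro α ⟨-, hα⟩
      change (α.degree : ℤ) + dg a' = e - 1
      rw [hα]
      ring
    · rw [Finsupp.single_eq_of_ne haa]
      exact zero_mem _
  · have hid : ∑ a, (j a).comp (π a) = AddMonoidHom.id _ := by
      refine AddMonoidHom.ext fun f => ?_
      rw [AddMonoidHom.finsetSum_apply]
      exact Finsupp.univ_sum_single f
    simp only [map_sum, Koszul.d_map (hj _), hdb, Koszul.map_map]
    rw [Koszul.sum_map, hid, Koszul.map_id]

section Cover

variable [Finite ι] {N : Type} [AddCommGroup N] [Module (MvPolynomial V k) N]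
  {φ : (ι →₀ MvPolynomial V k) →ₗ[MvPolynomial V k] N} {H : ℤ → AddSubgroup N}

theorem exact_succ_iff (hl : Enumerates l)
    (hφ : ∀ e, ∀ f ∈ freePiece k V dg {e}, φ f ∈ H e)
    (hsurj : ∀ e, ∀ n ∈ H e, ∃ f ∈ freePiece k V dg {e}, φ f = n)
    (hker : ∀ f, φ f = 0 → ∀ a, constantCoeff (f a) = 0) (s : ℕ) (e : ℤ) :
    Koszul.Exact (smulX k N) l (H e) (H (e - 1)) (s + 1) ↔
      Koszul.Exact (smulX k (ι →₀ MvPolynomial V k)) l (kerPiece dg φ (e + 1))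
        (kerPiece dg φ e) s := by
  constructor
  · exact Koszul.Exact.of_connecting (φ := φ.toAddMonoidHom) (Z := kerPiece dg φ)
      (G := fun e => freePiece k V dg {e}) (smulX_comm k)
      (fun x m => φ.map_smul _ _) smulX_mem_freePiece (fun e m hm => hm.2) hφ hsurj
      (fun e m hm h => ⟨hm, h⟩) (by
        have := exact_freePiece hl (s := s) (e := e + 1) (A := kerPiece dg φ (e + 1))
          (fun f hf => hf.1) (Or.inr fun f hf => hker f hf.2)
        rwa [add_sub_cancel_right] at this)
  · intro h
    refine Koszul.Exact.of_quotient (φ := φ.toAddMonoidHom) (Z := kerPiece dg φ)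
      (G := fun e => freePiece k V dg {e}) (smulX_comm k)
      (fun x m => φ.map_smul _ _) smulX_mem_freePiece (fun e f hf => hf.1)
      (fun e m hm => hm.2) hφ hsurj
      (fun e m hm h => ⟨hm, h⟩) (exact_freePiece hl le_rfl (Or.inl (by omega))) ?_
    rwa [add_sub_cancel_right]

theorem exact_zero_iff (hl : Enumerates l)
    (hφ : ∀ e, ∀ f ∈ freePiece k V dg {e}, φ f ∈ H e)
    (hsurj : ∀ e, ∀ n ∈ H e, ∃ f ∈ freePiece k V dg {e}, φ f = n)
    (hker : ∀ f, φ f = 0 → ∀ a, constantCoeff (f a) = 0) (e : ℤ) :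
    Koszul.Exact (smulX k N) l (H e) (H (e - 1)) 0 ↔ ∀ a, (dg a : ℤ) ≠ e := by
  classical
  constructor
  · rintro h a rfl
    have hm : (Finsupp.single a 1 : ι →₀ MvPolynomial V k) ∈ freePiece k V dg {(dg a : ℤ)} := by
      intro b α hα
      by_cases hba : b = a
      · subst hba
        rw [Finsupp.single_eq_same, coeff_one] at hα
        have : α = 0 := by
          by_contra hne
          exact hα (if_neg (Ne.symm hne))
        simp [this]
      · rw [Finsupp.single_eq_of_ne hba] at hα
        exact absurd (coeff_zero α) hα
    obtain ⟨b, hb, hdb⟩ := h _ (Koszul.bot_mem_chains (hφ _ _ hm)) (Koszul.d_bot _ _ _)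
    obtain ⟨g, -, rfl⟩ := Koszul.exists_lift (φ := φ.toAddMonoidHom) (hsurj _) hb
    have hT : ∀ x ∈ l, ∀ m, φ.toAddMonoidHom (smulX k _ x m) =
        smulX k _ x (φ.toAddMonoidHom m) := fun x _ m => φ.map_smul _ _
    rw [Koszul.d_map hT] at hdb
    have hfst := congrArg (Koszul.fstEntry l) hdb
    rw [Koszul.fstEntry_bot, Koszul.fstEntry_map] at hfst
    let A : AddSubgroup (ι →₀ MvPolynomial V k) :=
      ((constantCoeff : MvPolynomial V k →+* k).toAddMonoidHom.comp
        (Finsupp.applyAddHom a)).ker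
    have hA := Koszul.fstEntry_d_mem (T := smulX k (ι →₀ MvPolynomial V k)) (A := A)
      (fun x m => by
        change constantCoeff (X x * m a) = 0
        rw [map_mul, constantCoeff_X, zero_mul]) l g
    have h0 := hker (Finsupp.single a 1 - Koszul.fstEntry l (Koszul.d (smulX k _) l g))
      (by rw [map_sub, sub_eq_zero]; exact hfst.symm) a
    rw [Finsupp.sub_apply, map_sub, Finsupp.single_eq_same, map_one,
      show constantCoeff (Koszul.fstEntry l (Koszul.d (smulX k _) l g) a) = 0 from hA,
      sub_zero] at h0
    exact one_ne_zero h0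
  · intro h
    refine Koszul.Exact.of_quotient (φ := φ.toAddMonoidHom) (Z := kerPiece dg φ)
      (G := fun e => freePiece k V dg {e}) (smulX_comm k)
      (fun x m => φ.map_smul _ _) smulX_mem_freePiece (fun e f hf => hf.1)
      (fun e m hm => hm.2) hφ hsurj
      (fun e m hm h => ⟨hm, h⟩) (exact_freePiece hl le_rfl (Or.inr fun f hf a => ?_))
      (Koszul.exact_of_neg (by norm_num))
    by_contra h0
    refine h a ?_
    have := hf a 0 h0
    simpa using this

end Cover

end Free

end WOG

namespace WOG

variable {k : Type} [Field k] {V : Type} {l : List V}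

/-! ### Minimal free resolutions and Koszul homology -/

theorem constantCoeff_eq_zero_of_mem_mIdeal {f : MvPolynomial V k} (hf : f ∈ mIdeal k V) :
    constantCoeff f = 0 := by
  have hle : mIdeal k V ≤ RingHom.ker (constantCoeff : MvPolynomial V k →+* k) := by
    rw [mIdeal, Ideal.span_le]
    rintro _ ⟨x, rfl⟩
    exact constantCoeff_X k x
  exact hle hf

namespace MinFreeRes

variable {I : Ideal (MvPolynomial V k)} (R : MinFreeRes I)

/-- The degree `e` piece of the `n`-th syzygy module. -/
def syzygyPiece : (n : ℕ) → ℤ → AddSubgroup (R.ι n →₀ MvPolynomial V k)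
  | 0 => kerPiece (R.deg 0) R.aug
  | n + 1 => kerPiece (R.deg (n + 1)) (R.d n)

theorem d_apply_mem_mIdeal (n : ℕ) (g : R.ι (n + 1) →₀ MvPolynomial V k) (b : R.ι n) :
    R.d n g b ∈ mIdeal k V := by
  have h := linearMap_apply_eq_sum ((Finsupp.lapply b).comp (R.d n)) g
  rw [LinearMap.comp_apply, Finsupp.lapply_apply] at h
  rw [h]
  exact sum_mem fun a _ => Ideal.mul_mem_left _ _ (R.minimal n a b)

theorem constantCoeff_of_aug_eq_zero (f : R.ι 0 →₀ MvPolynomial V k) (hf : R.aug f = 0)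
    (a : R.ι 0) : constantCoeff (f a) = 0 := by
  have hf' : f ∈ LinearMap.range (R.d 0) := R.exact_zero ▸ hf
  obtain ⟨g, rfl⟩ := hf'
  exact constantCoeff_eq_zero_of_mem_mIdeal (R.d_apply_mem_mIdeal 0 g a)

theorem constantCoeff_of_d_eq_zero (n : ℕ) (f : R.ι (n + 1) →₀ MvPolynomial V k)
    (hf : R.d n f = 0) (a : R.ι (n + 1)) : constantCoeff (f a) = 0 := by
  have hf' : f ∈ LinearMap.range (R.d (n + 1)) := R.exact_succ n ▸ hf
  obtain ⟨g, rfl⟩ := hf'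
  exact constantCoeff_eq_zero_of_mem_mIdeal (R.d_apply_mem_mIdeal (n + 1) g a)

theorem aug_mem {P : Set ℤ} {f : R.ι 0 →₀ MvPolynomial V k}
    (hf : f ∈ freePiece k V (R.deg 0) P) :
    R.aug f ∈ suppIn k {α | (α.degree : ℤ) ∈ P} := by
  have := linearMap_apply_mem_suppIn (c := 0) (φ := R.aug)
    (fun a => Or.inr ⟨_, (zero_add _).symm, R.aug_homog a⟩) hf
  simpa using this

theorem d_mem_freePiece {P : Set ℤ} (n : ℕ) {f : R.ι (n + 1) →₀ MvPolynomial V k}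
    (hf : f ∈ freePiece k V (R.deg (n + 1)) P) : R.d n f ∈ freePiece k V (R.deg n) P :=
  fun b => linearMap_apply_mem_suppIn (φ := (Finsupp.lapply b).comp (R.d n))
    (fun a => R.d_homog n a b) hf

theorem d_mem_syzygyPiece (n : ℕ) (e : ℤ) (f : R.ι (n + 1) →₀ MvPolynomial V k)
    (hf : f ∈ freePiece k V (R.deg (n + 1)) {e}) : R.d n f ∈ R.syzygyPiece n e := by
  cases n with
  | zero =>
    have hker : R.d 0 f ∈ LinearMap.ker R.aug := R.exact_zero ▸ LinearMap.mem_range_self _ f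
    exact ⟨R.d_mem_freePiece 0 hf, hker⟩
  | succ n =>
    have hker : R.d (n + 1) f ∈ LinearMap.ker (R.d n) :=
      R.exact_succ n ▸ LinearMap.mem_range_self _ f
    exact ⟨R.d_mem_freePiece (n + 1) hf, hker⟩

theorem exists_d_eq (n : ℕ) (e : ℤ) (g : R.ι n →₀ MvPolynomial V k)
    (hg : g ∈ R.syzygyPiece n e) : ∃ f ∈ freePiece k V (R.deg (n + 1)) {e}, R.d n f = g := by
  have := R.finite (n + 1)
  have hg' : g ∈ freePiece k V (R.deg n) {e} ∧ g ∈ LinearMap.range (R.d n) := by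
    cases n with
    | zero => exact ⟨hg.1, R.exact_zero ▸ hg.2⟩
    | succ n => exact ⟨hg.1, R.exact_succ n ▸ hg.2⟩
  obtain ⟨hge, f, rfl⟩ := hg'
  obtain ⟨f₁, hf₁, f₂, hf₂, rfl⟩ := exists_freePiece_add (dg := R.deg (n + 1)) {e} f
  have h0 : R.d n f₂ = 0 := by
    refine freePiece_inter_eq_zero (P := {e}) ?_ (R.d_mem_freePiece n hf₂)
    rw [map_add] at hge
    exact (add_mem_cancel_left (R.d_mem_freePiece n hf₁)).1 hge
  exact ⟨f₁, hf₁, by rw [map_add, h0, add_zero]⟩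

variable {U : Set (V →₀ ℕ)}

theorem aug_mem_graded (hI : ∀ f, f ∈ I ↔ f ∈ suppIn k U) (e : ℤ)
    (f : R.ι 0 →₀ MvPolynomial V k) (hf : f ∈ freePiece k V (R.deg 0) {e}) :
    R.aug f ∈ graded k U e := by
  have hmem := LinearMap.mem_range_self R.aug f
  rw [R.aug_range] at hmem
  exact fun α hα => ⟨(hI _).1 hmem α hα, R.aug_mem hf α hα⟩

theorem exists_aug_eq (hI : ∀ f, f ∈ I ↔ f ∈ suppIn k U) (e : ℤ) (g : MvPolynomial V k)
    (hg : g ∈ graded k U e) : ∃ f ∈ freePiece k V (R.deg 0) {e}, R.aug f = g := by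
  have := R.finite 0
  have hgI : g ∈ LinearMap.range R.aug := by
    rw [R.aug_range]
    exact (hI g).2 (suppIn_mono (fun α hα => hα.1) hg)
  obtain ⟨f, rfl⟩ := hgI
  obtain ⟨f₁, hf₁, f₂, hf₂, rfl⟩ := exists_freePiece_add (dg := R.deg 0) {e} f
  have h0 : R.aug f₂ = 0 := by
    refine suppIn_inter_eq_zero disjoint_compl_right
      (P := {α | (α.degree : ℤ) ∈ ({e} : Set ℤ)}) ?_ (R.aug_mem hf₂)
    have hge : R.aug (f₁ + f₂) ∈ suppIn k {α | (α.degree : ℤ) ∈ ({e} : Set ℤ)} :=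
      suppIn_mono (fun α hα => hα.2) hg
    rw [map_add] at hge
    exact (add_mem_cancel_left (R.aug_mem hf₁)).1 hge
  exact ⟨f₁, hf₁, by rw [map_add, h0, add_zero]⟩

theorem exact_syzygyPiece_iff (hl : Enumerates l) (i n j : ℕ) (hj : j = n + 1 + i) (e : ℤ) :
    Koszul.Exact (smulX k _) l (R.syzygyPiece n e) (R.syzygyPiece n (e - 1)) i ↔
      ∀ a : R.ι j, (R.deg j a : ℤ) ≠ e + i := by
  have := R.finite (n + 1)
  induction i generalizing n e with
  | zero =>
    subst hj
    simp only [Nat.cast_zero, add_zero]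
    exact exact_zero_iff hl (R.d_mem_syzygyPiece n) (R.exists_d_eq n)
      (R.constantCoeff_of_d_eq_zero n) e
  | succ i ih =>
    rw [Nat.cast_succ]
    refine (exact_succ_iff hl (R.d_mem_syzygyPiece n) (R.exists_d_eq n)
      (R.constantCoeff_of_d_eq_zero n) i e).trans ?_
    have := ih (n + 1) (by omega) (e + 1) (R.finite _)
    rw [add_sub_cancel_right] at this
    refine this.trans (forall_congr' fun a => ?_)
    rw [add_assoc, add_comm 1 (i : ℤ)]

/-- The basis elements of the minimal resolution are detected by the Koszul homology of the
ideal. -/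
theorem exact_graded_iff (hl : Enumerates l) (hI : ∀ f, f ∈ I ↔ f ∈ suppIn k U) (i : ℕ)
    (e : ℤ) :
    Koszul.Exact (smulX k _) l (graded k U e) (graded k U (e - 1)) i ↔
      ∀ a : R.ι i, (R.deg i a : ℤ) ≠ e + i := by
  have := R.finite 0
  cases i with
  | zero =>
    rw [Nat.cast_zero, add_zero]
    exact exact_zero_iff hl (R.aug_mem_graded hI) (R.exists_aug_eq hI)
      R.constantCoeff_of_aug_eq_zero e
  | succ i =>
    rw [Nat.cast_succ]
    refine (exact_succ_iff hl (R.aug_mem_graded hI) (R.exists_aug_eq hI)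
      R.constantCoeff_of_aug_eq_zero i e).trans ?_
    have := R.exact_syzygyPiece_iff hl i 0 (i + 1) (by omega) (e + 1)
    rw [add_sub_cancel_right] at this
    refine this.trans (forall_congr' fun a => ?_)
    rw [add_assoc, add_comm 1 (i : ℤ)]

theorem betti_ne_zero_iff (i j : ℕ) : R.betti i j ≠ 0 ↔ ∃ a : R.ι i, R.deg i a = j := by
  have := R.finite i
  rw [betti, Nat.card_ne_zero, nonempty_subtype]
  exact and_iff_left inferInstance

end MinFreeRes

end WOG
namespace WOG

variable {k : Type} [Field k] {V : Type}

/-! ### The edge ideal -/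

theorem mem_edgeIdeal_iff (part w : V → ℕ) (f : MvPolynomial V k) :
    f ∈ edgeIdeal k {p : V × V | part p.2 = part p.1 + 1} w ↔
      f ∈ suppIn k (edgeSet part w 0) := by
  classical
  have hgen : {p : MvPolynomial V k | ∃ e ∈ {p : V × V | part p.2 = part p.1 + 1},
      p = X e.1 * X e.2 ^ w e.2} = (fun α => monomial α (1 : k)) ''
        ((fun e : V × V => Finsupp.single e.1 1 + Finsupp.single e.2 (w e.2)) ''
          {p : V × V | part p.2 = part p.1 + 1}) := by
    ext p
    simp only [Set.mem_image, exists_exists_and_eq_and, Set.mem_ofPred_eq]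
    refine exists_congr fun e => and_congr_right fun _ => ?_
    rw [X_pow_eq_monomial, X, monomial_mul, one_mul, eq_comm]
  rw [edgeIdeal, hgen, mem_ideal_span_monomial_image]
  change _ ↔ ∀ α, coeff α f ≠ 0 → α ∈ edgeSet part w 0
  simp only [mem_support_iff]
  refine forall₂_congr fun α _ => ?_
  simp only [Set.exists_mem_image, Prod.exists, edgeSet, Set.mem_ofPred_eq]
  refine exists₂_congr fun x y => and_congr_right fun hxy => ?_
  have hne : x ≠ y := by
    rintro rfl
    omega
  constructor
  · intro h
    have hx := h x
    have hy := h y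
    rw [Finsupp.add_apply, Finsupp.single_eq_same, Finsupp.single_eq_of_ne hne] at hx
    rw [Finsupp.add_apply, Finsupp.single_eq_same, Finsupp.single_eq_of_ne hne.symm] at hy
    exact ⟨Nat.zero_le _, by omega, by omega⟩
  · rintro ⟨-, hx, hy⟩ z
    rw [Finsupp.add_apply, Finsupp.single_apply, Finsupp.single_apply]
    split_ifs with h₁ h₂ h₂
    · exact absurd (h₁.trans h₂.symm) hne
    · subst h₁
      omega
    · subst h₂
      omega
    · omega

theorem not_exact_edgeSet {part w : V → ℕ} {l' l : List V} (hl : Enumerates (l' ++ l))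
    (hl₀ : ∀ x, x ∈ l ↔ part x = 0) (hl' : ∀ x, x ∈ l' ↔ part x ≠ 0)
    (hpred : ∀ y, part y ≠ 0 → ∃ x, part x + 1 = part y)
    (hone : ∃ y, part y = 1) (hw₁ : ∀ x, part x = 0 → w x = 1)
    (hw2 : ∀ x y, part y = part x + 1 → part x ≠ 0 → 2 ≤ w x)
    {ω : V →₀ ℕ} (hω : ∀ x, ω x + 1 = w x) :
    ¬ Koszul.Exact (smulX k (MvPolynomial V k)) (l' ++ l)
      (graded k (edgeSet part w 0) (ω.degree + 2))
      (graded k (edgeSet part w 0) (ω.degree + 1)) ((l' ++ l).length - 2) := by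
  classical
  obtain ⟨y, hy⟩ := hone
  obtain ⟨x, hx⟩ := hpred y (by omega)
  refine not_exact_graded hl (x := x) (y := y) ?_ ((hl₀ x).2 (by omega)) ?_
    ((hl' y).2 (by omega)) ?_
  · intro y hy x hx
    rw [hl'] at hy
    rw [hl₀] at hx
    obtain ⟨z, hz⟩ := hpred y hy
    have hwy := hω y
    by_cases hz₀ : part z = 0
    · refine ⟨x, y, by omega, Nat.zero_le _, ?_, ?_⟩
      · simp [Finsupp.single_apply]
      · simp only [Finsupp.add_apply, Finsupp.single_eq_same]
        omega
    · refine ⟨z, y, by omega, Nat.zero_le _, ?_, ?_⟩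
      · have h₁ := hω z
        have h₂ := hw2 z y hz.symm hz₀
        simp only [Finsupp.add_apply]
        omega
      · simp only [Finsupp.add_apply, Finsupp.single_eq_same]
        omega
  · rintro ⟨a, b, hab, -, -, hb⟩
    have := hω b
    rw [single_add_apply_of_ne (by rintro rfl; omega)] at hb
    omega
  · rintro ⟨a, b, hab, -, ha, hb⟩
    have h₁ := hω b
    by_cases hby : y = b
    · subst hby
      have h₂ := hω a
      have h₃ := hw₁ a (by omega)
      rw [single_add_apply_of_ne (by rintro rfl; omega)] at ha
      omega
    · rw [single_add_apply_of_ne (Ne.symm hby)] at hb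
      omega

theorem regLE_edgeSet {l : List V} [Fintype V] (hl : Enumerates l) {part w : V → ℕ} {m : ℕ}
    (hm : 2 ≤ m) (hlt : ∀ x, part x < m) (hne : ∀ i < m, ∃ x, part x = i)
    (hw : ∀ x, 1 ≤ w x) (hw₁ : ∀ x, part x = 0 → w x = 1)
    (hw2 : ∀ x, part x ≠ 0 → part x ≠ m - 1 → 2 ≤ w x) {t : ℕ}
    (ht : 2 + ∑ x, (w x - 1) ≤ t) : RegLE k l (edgeSet part w 0) t := by
  have hsum : ∑ x, stageCost part w 0 0 x = ∑ x, (w x - 1) := by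
    refine Finset.sum_congr rfl fun x _ => ?_
    have := hw₁ x
    simp only [stageCost, Pi.zero_apply]
    split_ifs <;> omega
  have h := regLE_stage (k := k) hl hlt hne hw hw2 (m - 1) 0 (by omega) 0 (fun _ _ => rfl) t
    (by rw [hsum]; omega) (fun _ _ => by rw [hsum]; omega)
  have hempty : powerSet (0 : V → ℕ) = ∅ :=
    Set.eq_empty_iff_forall_notMem.2 fun α ⟨y, hy, _⟩ => hy rfl
  rwa [hempty, Set.empty_union] at h

end WOG

/-- **Theorem (first class, regularity).**
`D` is a vertex-weighted oriented `m`-partite graph (`m ≥ 2`) of the first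
class: its vertex set is partitioned into nonempty parts `V_1, …, V_m`
(encoded by `part : V → Fin m`), and its edges are exactly all pairs going
from a vertex of `V_i` to a vertex of `V_{i+1}` (`1 ≤ i ≤ m-1`), i.e. each
`D_i` is a complete bipartite graph oriented from `V_i` to `V_{i+1}`.
Sources have weight `1` and vertices outside `V_1 ⊔ V_m` have weight `≥ 2`.
Then `reg I(D) = (∑_{x ∈ V} w(x)) - |V| + 2`. -/
theorem first_class_reg (k : Type) [Field k] (m : ℕ) (hm : 2 ≤ m)
    (V : Type) [Fintype V] (part : V → Fin m) (hpart : ∀ i : Fin m, ∃ x : V, part x = i)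
    (E : Set (V × V))
    (hE : E = {p : V × V | (part p.2 : ℕ) = (part p.1 : ℕ) + 1})
    (w : V → ℕ) (hw : ∀ x : V, 1 ≤ w x)
    (hsrc : ∀ x : V, (∀ y : V, (y, x) ∉ E) → w x = 1)
    (hw2 : ∀ x : V, (part x : ℕ) ≠ 0 → (part x : ℕ) ≠ m - 1 → 2 ≤ w x)
    (R : WOG.MinFreeRes (WOG.edgeIdeal k E w)) :
    IsGreatest R.regSet ((∑ x : V, (w x : ℤ)) - (Fintype.card V : ℤ) + 2) := by
  classical
  have hlt : ∀ x, (part x : ℕ) < m := fun x => (part x).2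
  have hne : ∀ i < m, ∃ x, (part x : ℕ) = i := fun i hi =>
    (hpart ⟨i, hi⟩).imp fun x hx => by rw [hx]
  have hw₁ : ∀ x, (part x : ℕ) = 0 → w x = 1 := fun x hx => hsrc x fun y hy => by
    rw [hE] at hy
    have : (part x : ℕ) = part y + 1 := hy
    omega
  have hI : ∀ f, f ∈ WOG.edgeIdeal k E w ↔
      f ∈ WOG.suppIn k (WOG.edgeSet (fun x => (part x : ℕ)) w 0) := fun f => by
    rw [hE]
    exact WOG.mem_edgeIdeal_iff (fun x => (part x : ℕ)) w f
  have hsum : ((∑ x, (w x - 1) : ℕ) : ℤ) = ∑ x, (w x : ℤ) - Fintype.card V := by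
    rw [Nat.cast_sum, Finset.sum_congr rfl fun x _ => Nat.cast_sub (hw x),
      Finset.sum_sub_distrib]
    simp
  constructor
  · let l := (Finset.univ.filter fun x => (part x : ℕ) = 0).toList
    let l' := (Finset.univ.filter fun x => (part x : ℕ) ≠ 0).toList
    let ω : V →₀ ℕ := Finsupp.equivFunOnFinite.symm fun x => w x - 1
    have hmem : ∀ x, x ∈ l ↔ (part x : ℕ) = 0 := fun x => by simp [l]
    have hmem' : ∀ x, x ∈ l' ↔ (part x : ℕ) ≠ 0 := fun x => by simp [l']
    have hl : WOG.Enumerates (l' ++ l) := by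
      refine ⟨List.nodup_append'.2 ⟨Finset.nodup_toList _, Finset.nodup_toList _,
        fun x hx' hx => (hmem' x).1 hx' ((hmem x).1 hx)⟩, fun x => ?_⟩
      rw [List.mem_append, hmem, hmem']
      exact (em _).symm
    have hlen : (l' ++ l).length = Fintype.card V := by
      rw [← List.toFinset_card_of_nodup hl.nodup]
      exact congrArg _ (Finset.eq_univ_iff_forall.2 fun x => List.mem_toFinset.2 (hl.mem x))
    have hcard : 2 ≤ Fintype.card V := by
      have := Fintype.card_le_of_surjective part hpart
      rw [Fintype.card_fin] at this
      omega
    have hdeg : ω.degree = ∑ x, (w x - 1) := Finsupp.degree_eq_sum ω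
    have h := WOG.not_exact_edgeSet (k := k) hl hmem hmem'
      (fun y hy => (hne (part y - 1) (by have := hlt y; omega)).imp fun x hx => by omega)
      (hne 1 hm) hw₁
      (fun x y hxy hx => hw2 x hx (by have := hlt y; omega))
      (ω := ω) fun x => Nat.sub_add_cancel (hw x)
    have hi : (((l' ++ l).length : ℤ) - 2) = ((Fintype.card V - 2 : ℕ) : ℤ) := by
      rw [hlen, Nat.cast_sub hcard, Nat.cast_two]
    rw [hi, show (ω.degree : ℤ) + 1 = ω.degree + 2 - 1 by ring,
      R.exact_graded_iff hl hI] at h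
    push Not at h
    obtain ⟨a, ha⟩ := h
    refine ⟨Fintype.card V - 2, _, (R.betti_ne_zero_iff _ _).2 ⟨a, rfl⟩, ?_⟩
    rw [ha, hdeg, hsum]
    ring
  · rintro _ ⟨i, j, hij, rfl⟩
    obtain ⟨a, rfl⟩ := (R.betti_ne_zero_iff _ _).1 hij
    have hl : WOG.Enumerates (Finset.univ : Finset V).toList :=
      ⟨Finset.nodup_toList _, fun x => Finset.mem_toList.2 (Finset.mem_univ x)⟩
    by_contra! hlt'
    refine (R.exact_graded_iff hl hI i (R.deg i a - i)).1 ?_ a (by ring)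
    refine WOG.regLE_edgeSet hl hm hlt hne hw hw₁ hw2 le_rfl _ _ ?_
    rw [Nat.cast_add, hsum, Nat.cast_two]
    linarith
end
end

section
/- Let m ≥ 2 be an integer and let D = (V,E,w) be a vertex-weighted oriented m-partite graph of the first class (with m parts). Assume w(x) = 1 for every source vertex of D (i.e., every vertex of V_1) and w(x) ≥ 2 for every x ∈ V \ (V_1 ⊔ V_m). Then depth(I(D)) = 2. -/
open MvPolynomial

noncomputable section

section Koszul

variable {R ι : Type*} [CommRing R] {t : ι → R} {r : R} {M : Type*} [AddCommGroup M] [Module R M]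

/-- Vanishing of Koszul `0`-cocycles on a module of positive depth. -/
theorem eq_zero_of_forall_smul_eq_zero [Finite ι] (hr : r ∈ (Ideal.span (Set.range t)).radical)
    (hreg : IsSMulRegular M r) (x : M) (hx : ∀ i, t i • x = 0) : x = 0 := by
  have := Fintype.ofFinite ι
  obtain ⟨N, hN⟩ := hr
  obtain ⟨l, hl⟩ := Ideal.mem_span_range_iff_exists_fun.1 hN
  refine (hreg.pow N).right_eq_zero_of_smul ?_
  rw [← hl, Finset.sum_smul]
  exact Finset.sum_eq_zero fun i _ => by rw [mul_smul, hx, smul_zero]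

/-- Koszul `1`-cocycles on a module of depth at least two are coboundaries. -/
theorem exists_eq_smul_of_smul_comm [Finite ι] (hr : r ∈ (Ideal.span (Set.range t)).radical)
    (hreg : IsSMulRegular M r)
    (h0 : ∀ x : QuotSMulTop r M, (∀ i, t i • x = 0) → x = 0)
    (c : ι → M) (hc : ∀ i j, t i • c j = t j • c i) : ∃ s, ∀ i, c i = t i • s := by
  have := Fintype.ofFinite ι
  obtain ⟨N, hN⟩ := hr
  obtain ⟨l, hl⟩ := Ideal.mem_span_range_iff_exists_fun.1 hN
  have key : ∃ s, ∀ i, r ^ N • c i = t i • s := by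
    refine ⟨∑ j, l j • c j, fun i => ?_⟩
    rw [← hl, Finset.sum_smul, Finset.smul_sum]
    refine Finset.sum_congr rfl fun j _ => ?_
    rw [mul_smul, hc j i, smul_comm]
  clear hl hN
  induction N with
  | zero => simpa using key
  | succ N ih =>
    refine ih ?_
    obtain ⟨s, hs⟩ := key
    have hs0 : (Submodule.Quotient.mk s : QuotSMulTop r M) = 0 := by
      refine h0 _ fun i => ?_
      rw [← Submodule.Quotient.mk_smul, Submodule.Quotient.mk_eq_zero, ← hs i, pow_succ',
        mul_smul]
      exact Submodule.smul_mem_pointwise_smul _ _ _ trivial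
    obtain ⟨s', -, hs'⟩ := (Submodule.mem_smul_pointwise_iff_exists _ _ _).1
      ((Submodule.Quotient.mk_eq_zero _).1 hs0)
    refine ⟨s', fun i => hreg ?_⟩
    change r • r ^ N • c i = r • t i • s'
    rw [← mul_smul, ← pow_succ', hs i, ← hs', smul_comm]

/-- Koszul `2`-cocycles on a module of depth at least three are coboundaries. -/
theorem exists_eq_smul_sub_smul [Finite ι] (hr : r ∈ (Ideal.span (Set.range t)).radical)
    (hreg : IsSMulRegular M r)
    (h1 : ∀ c : ι → QuotSMulTop r M, (∀ i j, t i • c j = t j • c i) →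
      ∃ s, ∀ i, c i = t i • s)
    (a : ι → ι → M) (ha : ∀ i j l, t l • a i j = t i • a l j - t j • a l i) :
    ∃ c : ι → M, ∀ i j, a i j = t i • c j - t j • c i := by
  have := Fintype.ofFinite ι
  obtain ⟨N, hN⟩ := hr
  obtain ⟨l, hl⟩ := Ideal.mem_span_range_iff_exists_fun.1 hN
  have key : ∃ c : ι → M, ∀ i j, r ^ N • a i j = t i • c j - t j • c i := by
    refine ⟨fun j => ∑ q, l q • a q j, fun i j => ?_⟩
    rw [← hl, Finset.sum_smul, Finset.smul_sum, Finset.smul_sum, ← Finset.sum_sub_distrib]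
    refine Finset.sum_congr rfl fun q _ => ?_
    rw [mul_smul, ha i j q, smul_sub, smul_comm (l q), smul_comm (l q)]
  clear hl hN
  induction N with
  | zero => simpa using key
  | succ N ih =>
    refine ih ?_
    obtain ⟨c, hc⟩ := key
    obtain ⟨s, hs⟩ := h1 (fun i => Submodule.Quotient.mk (c i)) fun i j => by
      rw [← Submodule.Quotient.mk_smul, ← Submodule.Quotient.mk_smul, Submodule.Quotient.eq,
        ← hc, pow_succ', mul_smul]
      exact Submodule.smul_mem_pointwise_smul _ _ _ trivial
    obtain ⟨s, rfl⟩ := Submodule.Quotient.mk_surjective _ s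
    have hs' : ∀ i, ∃ c', c i - t i • s = r • c' := fun i => by
      have h := hs i
      rw [← Submodule.Quotient.mk_smul, Submodule.Quotient.eq] at h
      obtain ⟨c', -, h'⟩ := (Submodule.mem_smul_pointwise_iff_exists _ _ _).1 h
      exact ⟨c', h'.symm⟩
    choose c' hc' using hs'
    refine ⟨c', fun i j => hreg ?_⟩
    change r • r ^ N • a i j = r • (t i • c' j - t j • c' i)
    rw [← mul_smul, ← pow_succ', hc i j, smul_sub, smul_comm r, smul_comm r, ← hc', ← hc',
      smul_sub, smul_sub, smul_comm (t i) (t j) s]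
    abel

/-- Koszul `2`-cocycles on a module with a weakly regular sequence of length at least three,
all of whose members have a power in the ideal generated by `t`, are coboundaries. -/
theorem exists_eq_smul_sub_smul_of_isWeaklyRegular [Finite ι] {rs : List R}
    (hlen : 3 ≤ rs.length) (hrs : ∀ r ∈ rs, r ∈ (Ideal.span (Set.range t)).radical)
    (hreg : RingTheory.Sequence.IsWeaklyRegular M rs)
    (a : ι → ι → M) (ha : ∀ i j l, t l • a i j = t i • a l j - t j • a l i) :
    ∃ c : ι → M, ∀ i j, a i j = t i • c j - t j • c i := by
  match rs, hlen with
  | r₁ :: r₂ :: r₃ :: rs, _ =>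
    simp only [RingTheory.Sequence.isWeaklyRegular_cons_iff] at hreg
    obtain ⟨g₁, g₂, g₃, -⟩ := hreg
    exact exists_eq_smul_sub_smul (hrs r₁ (by simp)) g₁
      (exists_eq_smul_of_smul_comm (hrs r₂ (by simp)) g₂
        (eq_zero_of_forall_smul_eq_zero (hrs r₃ (by simp)) g₃)) a ha

end Koszul

section Monomial

variable {k V : Type} [Field k]

/-- The monomial `b` is divisible by some generator `x * y ^ w y` of the edge ideal. -/
def DivByEdge (E : Set (V × V)) (w : V → ℕ) (b : V →₀ ℕ) : Prop :=
  ∃ e ∈ E, 1 ≤ b e.1 ∧ w e.2 ≤ b e.2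

theorem mem_edgeIdeal_iff {E : Set (V × V)} (hE : ∀ e ∈ E, e.1 ≠ e.2) {w : V → ℕ}
    {p : MvPolynomial V k} :
    p ∈ WOG.edgeIdeal k E w ↔ ∀ b ∈ p.support, DivByEdge E w b := by
  classical
  have h : WOG.edgeIdeal k E w = Ideal.span ((fun s => monomial s (1 : k)) ''
      {s | ∃ e ∈ E, s = Finsupp.single e.1 1 + Finsupp.single e.2 (w e.2)}) := by
    unfold WOG.edgeIdeal
    congr 1
    ext p
    constructor
    · rintro ⟨e, he, rfl⟩
      refine ⟨_, ⟨e, he, rfl⟩, ?_⟩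
      simp [X, monomial_pow, monomial_mul]
    · rintro ⟨_, ⟨e, he, rfl⟩, rfl⟩
      refine ⟨e, he, ?_⟩
      simp [X, monomial_pow, monomial_mul]
  rw [h, mem_ideal_span_monomial_image]
  refine forall₂_congr fun b _ => ?_
  constructor
  · rintro ⟨_, ⟨e, he, rfl⟩, hle⟩
    have h1 := hle e.1
    have h2 := hle e.2
    simp only [Finsupp.add_apply, Finsupp.single_eq_same] at h1 h2
    exact ⟨e, he, by omega, by omega⟩
  · rintro ⟨e, he, h1, h2⟩
    refine ⟨_, ⟨e, he, rfl⟩, fun v => ?_⟩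
    have hne := hE e he
    simp only [Finsupp.add_apply, Finsupp.single_apply]
    split_ifs with h3 h4 h4
    · exact absurd (h3.trans h4.symm) hne
    · subst h3; simpa using h1
    · subst h4; simpa using h2
    · simp

theorem divByEdge_of_monomial_mul_mem {E : Set (V × V)} (hE : ∀ e ∈ E, e.1 ≠ e.2)
    {w : V → ℕ} {d b : V →₀ ℕ} {p : MvPolynomial V k}
    (hp : monomial d 1 * p ∈ WOG.edgeIdeal k E w) (hb : coeff b p ≠ 0) :
    DivByEdge E w (d + b) := by
  refine (mem_edgeIdeal_iff hE).1 hp _ ?_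
  rw [mem_support_iff, coeff_monomial_mul, one_mul]
  exact hb

theorem monomial_mem_edgeIdeal {E : Set (V × V)} (hE : ∀ e ∈ E, e.1 ≠ e.2)
    {w : V → ℕ} {b : V →₀ ℕ} (hb : DivByEdge E w b) :
    monomial b (1 : k) ∈ WOG.edgeIdeal k E w := by
  refine (mem_edgeIdeal_iff hE).2 fun c hc => ?_
  rwa [Finset.mem_singleton.1 (support_monomial_subset hc)]

end Monomial

theorem one_notMem_mIdeal {k V : Type} [Field k] :
    (1 : MvPolynomial V k) ∉ WOG.mIdeal k V := by
  intro h
  have hle : WOG.mIdeal k V ≤ RingHom.ker (constantCoeff (σ := V) (R := k)) := by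
    refine Ideal.span_le.2 ?_
    rintro _ ⟨v, rfl⟩
    simp
  simpa using hle h

/-- A nonzero ideal `I` is not equal to `𝔪 I`. -/
theorem top_ne_smul_top_of_le_mIdeal {k V : Type} [Field k] [Finite V]
    {I J : Ideal (MvPolynomial V k)} (hI : I ≠ ⊥) (hJ : J ≤ WOG.mIdeal k V) :
    (⊤ : Submodule (MvPolynomial V k) I) ≠ J • ⊤ := by
  intro h
  obtain ⟨r, hr, hr0⟩ := Submodule.exists_sub_one_mem_and_smul_eq_zero_of_fg_of_le_smul J
    (⊤ : Submodule (MvPolynomial V k) I) (IsNoetherian.noetherian _) h.le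
  obtain ⟨f, hf, hf0⟩ := Submodule.exists_mem_ne_zero_of_ne_bot hI
  have hrf : r * f = 0 := congrArg Subtype.val (hr0 ⟨f, hf⟩ trivial)
  have : r = 0 := (mul_eq_zero.1 hrf).resolve_right hf0
  subst this
  exact one_notMem_mIdeal (hJ (by simpa using hr))

/-- Two coprime elements `p, q` form a weakly `I`-regular sequence if `I : (p, q) = I`. -/
theorem isWeaklyRegular_pair_of_colon {R : Type*} [CommRing R] [IsDomain R] {I : Ideal R}
    {p q : R} (hp : Prime p) (hpq : ¬ p ∣ q)
    (h : ∀ s, p * s ∈ I → q * s ∈ I → s ∈ I) :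
    RingTheory.Sequence.IsWeaklyRegular I [p, q] := by
  rw [RingTheory.Sequence.isWeaklyRegular_cons_iff,
    RingTheory.Sequence.isWeaklyRegular_singleton_iff]
  refine ⟨fun a b hab => ?_, ?_⟩
  · exact Subtype.ext (mul_left_cancel₀ hp.ne_zero (congrArg Subtype.val hab))
  · refine (isSMulRegular_iff_right_eq_zero_of_smul).2 fun g hg => ?_
    obtain ⟨g, rfl⟩ := Submodule.Quotient.mk_surjective _ g
    rw [← Submodule.Quotient.mk_smul, Submodule.Quotient.mk_eq_zero] at hg
    obtain ⟨b, -, hb⟩ := (Submodule.mem_smul_pointwise_iff_exists _ _ _).1 hg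
    have hb' : p * (b : R) = q * (g : R) := congrArg Subtype.val hb
    obtain ⟨s, hs⟩ := (hp.dvd_or_dvd (Dvd.intro _ hb')).resolve_left hpq
    have hbs : (b : R) = q * s := mul_left_cancel₀ hp.ne_zero (by rw [hb', hs]; ring)
    have hsI : s ∈ I := h s (hs ▸ g.2) (hbs ▸ b.2)
    rw [Submodule.Quotient.mk_eq_zero]
    exact (Submodule.mem_smul_pointwise_iff_exists _ _ _).2
      ⟨⟨s, hsI⟩, trivial, Subtype.ext hs.symm⟩

/-- A variable in the first part and a variable in the second part generate an ideal with
`I(D) : (x, y) = I(D)`. -/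
theorem mem_edgeIdeal_of_X_mul_mem {k V : Type} [Field k] {m : ℕ} {part : V → Fin m}
    {E : Set (V × V)} (hE : E = {p : V × V | (part p.2 : ℕ) = (part p.1 : ℕ) + 1})
    {w : V → ℕ} (hw : ∀ x : V, 1 ≤ w x) {x y : V} (hx : (part x : ℕ) = 0)
    (hy : (part y : ℕ) = 1) {s : MvPolynomial V k}
    (hxs : X x * s ∈ WOG.edgeIdeal k E w) (hys : X y * s ∈ WOG.edgeIdeal k E w) :
    s ∈ WOG.edgeIdeal k E w := by
  classical
  have hne : ∀ e ∈ E, e.1 ≠ e.2 := by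
    rintro e he heq
    simp [hE, heq] at he
  refine (mem_edgeIdeal_iff hne).2 fun b hb => ?_
  rw [mem_support_iff] at hb
  obtain ⟨⟨u, v⟩, he, h1, h2⟩ := divByEdge_of_monomial_mul_mem hne hxs hb
  obtain ⟨⟨u', v'⟩, he', h1', h2'⟩ := divByEdge_of_monomial_mul_mem hne hys hb
  subst hE
  simp only [Set.mem_ofPred_eq, Finsupp.add_apply, Finsupp.single_apply] at he h1 h2 he' h1' h2'
  have hxv : x ≠ v := by rintro rfl; omega
  rw [if_neg hxv] at h2
  by_cases hxu : x = u
  · subst hxu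
    have hwv := hw v
    by_cases hyu : y = u'
    · subst hyu
      have : y ≠ v' := by rintro rfl; omega
      rw [if_neg this] at h2'
      exact ⟨(v, v'), by simp only [Set.mem_ofPred_eq]; omega, by simp only; omega,
        by simp only; omega⟩
    · rw [if_neg hyu] at h1'
      by_cases hyv : y = v'
      · subst hyv
        exact ⟨(u', v), by simp only [Set.mem_ofPred_eq]; omega, by simp only; omega,
          by simp only; omega⟩
      · rw [if_neg hyv] at h2'
        exact ⟨(u', v'), he', by simp only; omega, by simp only; omega⟩
  · rw [if_neg hxu] at h1
    exact ⟨(u, v), he, by simp only; omega, by simp only; omega⟩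

/-- The edge ideal of a graph of the first class has no weakly regular sequence of length three
in the maximal graded ideal. -/
theorem length_le_two_of_isWeaklyRegular {k V : Type} [Field k] [Finite V] {m : ℕ} (hm : 2 ≤ m)
    {part : V → Fin m} (hpart : ∀ i : Fin m, ∃ x : V, part x = i)
    {E : Set (V × V)} (hE : E = {p : V × V | (part p.2 : ℕ) = (part p.1 : ℕ) + 1})
    {w : V → ℕ} (hw : ∀ x : V, 1 ≤ w x)
    (hw2 : ∀ x : V, (part x : ℕ) ≠ 0 → (part x : ℕ) ≠ m - 1 → 2 ≤ w x)
    {rs : List (MvPolynomial V k)} (hrs : ∀ r ∈ rs, r ∈ WOG.mIdeal k V)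
    (hreg : RingTheory.Sequence.IsWeaklyRegular (WOG.edgeIdeal k E w) rs) :
    rs.length ≤ 2 := by
  classical
  by_contra! hlen
  have hne : ∀ e ∈ E, e.1 ≠ e.2 := by
    rintro e he heq
    simp [hE, heq] at he
  set I := WOG.edgeIdeal k E w with hI
  let t : V → MvPolynomial V k := fun v => monomial (Finsupp.single v (w v)) 1
  have ht : ∀ v, t v = X v ^ w v := fun v => by simp [t, X, monomial_pow]
  let A : V →₀ ℕ := Finsupp.equivFunOnFinite.symm fun v =>
    if (part v : ℕ) ≠ 0 ∧ (part v : ℕ) ≠ m - 1 then w v - 1 else 0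
  have hA : ∀ v, A v = if (part v : ℕ) ≠ 0 ∧ (part v : ℕ) ≠ m - 1 then w v - 1 else 0 :=
    fun v => rfl
  have hAlt : ∀ v, A v < w v := fun v => by
    have := hw v
    rw [hA]; split_ifs <;> omega
  let c : V → MvPolynomial V k := fun v => if (part v : ℕ) = 0 then t v * monomial A 1 else 0
  have hmixed : ∀ u v, (part u : ℕ) = 0 → (part v : ℕ) ≠ 0 →
      t v * (t u * monomial A 1) ∈ I := by
    intro u v hu hv
    simp only [t, monomial_mul, mul_one]
    refine monomial_mem_edgeIdeal hne ?_
    have hwu := hw u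
    by_cases hv1 : (part v : ℕ) = 1
    · refine ⟨(u, v), by simp [hE, hu, hv1], ?_, ?_⟩ <;>
        simp only [Finsupp.add_apply, Finsupp.single_eq_same] <;> omega
    · obtain ⟨z, hz⟩ := hpart ⟨(part v : ℕ) - 1, by omega⟩
      have hz' : (part z : ℕ) = (part v : ℕ) - 1 := by rw [hz]
      have hvm := (part v).isLt
      have hwz := hw2 z (by omega) (by omega)
      have hAz : A z = w z - 1 := by rw [hA, if_pos]; omega
      refine ⟨(z, v), by simp only [hE, Set.mem_ofPred_eq]; omega, ?_, ?_⟩ <;>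
        simp only [Finsupp.add_apply, Finsupp.single_eq_same] <;> omega
  have haI : ∀ u v, t u * c v - t v * c u ∈ I := by
    intro u v
    simp only [c]
    split_ifs with hv hu hu
    · convert I.zero_mem using 1; ring
    · simpa using hmixed v u hv hu
    · simpa using hmixed u v hu hv
    · simp
  have hmrad : WOG.mIdeal k V ≤ (Ideal.span (Set.range t)).radical := by
    refine Ideal.span_le.2 ?_
    rintro _ ⟨v, rfl⟩
    exact ⟨w v, ht v ▸ Ideal.subset_span ⟨v, rfl⟩⟩
  obtain ⟨c', hc'⟩ := exists_eq_smul_sub_smul_of_isWeaklyRegular (t := t) hlen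
    (fun r hr => hmrad (hrs r hr)) hreg (fun u v => ⟨_, haI u v⟩) (fun i j l => by
      apply Subtype.ext
      simp only [Submodule.coe_smul, Submodule.coe_sub, smul_eq_mul]
      ring)
  have hcc : ∀ u v, t u * c v - t v * c u = t u * (c' v : MvPolynomial V k) - t v * c' u :=
    fun u v => congrArg Subtype.val (hc' u v)
  obtain ⟨x, hx⟩ := hpart ⟨0, by omega⟩
  obtain ⟨y, hy⟩ := hpart ⟨1, by omega⟩
  have hx0 : (part x : ℕ) = 0 := by rw [hx]
  have hy1 : (part y : ℕ) = 1 := by rw [hy]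
  have hxy : x ≠ y := by rintro rfl; omega
  have htx : t x ≠ 0 := by simp [t]
  have hdvd : t x ∣ c x - c' x := by
    have h1 : t x ∣ t y * (c x - c' x) := ⟨c y - c' y, by linear_combination -(hcc x y)⟩
    rw [ht] at h1 ⊢
    refine X_prime.pow_dvd_of_dvd_mul_left _ (fun h => ?_) h1
    rw [ht] at h
    exact hxy (by simpa [X_dvd_X] using X_prime.dvd_of_dvd_pow h)
  obtain ⟨s, hs⟩ := hdvd
  have hsy : c y - c' y = t y * s := mul_left_cancel₀ htx (by
    linear_combination hcc x y + t y * hs)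
  have hcx : c x = t x * monomial A 1 := if_pos hx0
  have hcy : c y = 0 := if_neg (by omega)
  have hxI : t x * (monomial A 1 - s) ∈ I := by
    have : t x * (monomial A 1 - s) = (c' x : MvPolynomial V k) := by linear_combination hs - hcx
    rw [this]; exact (c' x).2
  have hyI : t y * s ∈ I := by
    rw [← hsy, hcy, zero_sub]; exact I.neg_mem (c' y).2
  have hcoef : coeff A s = 1 := by
    by_contra hcon
    obtain ⟨⟨u, v⟩, he, -, h2⟩ := divByEdge_of_monomial_mul_mem (b := A) hne hxI (by
      rw [coeff_sub, coeff_monomial, if_pos rfl]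
      exact sub_ne_zero.2 (Ne.symm hcon))
    simp only [hE, Set.mem_ofPred_eq] at he
    have hxv : x ≠ v := by rintro rfl; omega
    have := hAlt v
    simp only [Finsupp.add_apply, Finsupp.single_apply, if_neg hxv] at h2
    omega
  obtain ⟨⟨u, v⟩, he, h1, h2⟩ := divByEdge_of_monomial_mul_mem (b := A) hne hyI (by
    rw [hcoef]; exact one_ne_zero)
  simp only [hE, Set.mem_ofPred_eq] at he
  have := hAlt v
  simp only [Finsupp.add_apply, Finsupp.single_apply] at h1 h2
  by_cases hyv : y = v
  · subst hyv
    have hyu : y ≠ u := by rintro rfl; omega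
    rw [if_neg hyu, hA, if_neg (by omega)] at h1
    omega
  · rw [if_neg hyv] at h2
    omega

/-- **Theorem (first class, depth).**
`D` is a vertex-weighted oriented `m`-partite graph (`m ≥ 2`) of the first
class: its vertex set is partitioned into nonempty parts `V_1, …, V_m`
(encoded by `part : V → Fin m`), and its edges are exactly all pairs going
from a vertex of `V_i` to a vertex of `V_{i+1}` (`1 ≤ i ≤ m-1`), i.e. each
`D_i` is a complete bipartite graph oriented from `V_i` to `V_{i+1}`.
Sources have weight `1` and vertices outside `V_1 ⊔ V_m` have weight `≥ 2`.
Then `depth I(D) = 2`, where the depth (w.r.t. the maximal graded ideal `𝔪`)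
is the greatest length of an `I(D)`-regular sequence contained in `𝔪`. -/
theorem first_class_depth (k : Type) [Field k] (m : ℕ) (hm : 2 ≤ m)
    (V : Type) [Fintype V] (part : V → Fin m) (hpart : ∀ i : Fin m, ∃ x : V, part x = i)
    (E : Set (V × V))
    (hE : E = {p : V × V | (part p.2 : ℕ) = (part p.1 : ℕ) + 1})
    (w : V → ℕ) (hw : ∀ x : V, 1 ≤ w x)
    (hsrc : ∀ x : V, (∀ y : V, (y, x) ∉ E) → w x = 1)
    (hw2 : ∀ x : V, (part x : ℕ) ≠ 0 → (part x : ℕ) ≠ m - 1 → 2 ≤ w x) :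
    IsGreatest (WOG.depthSet k (WOG.edgeIdeal k E w)) 2 := by
  obtain ⟨x, hx⟩ := hpart ⟨0, by omega⟩
  obtain ⟨y, hy⟩ := hpart ⟨1, by omega⟩
  have hx0 : (part x : ℕ) = 0 := by rw [hx]
  have hy1 : (part y : ℕ) = 1 := by rw [hy]
  have hxy : x ≠ y := by rintro rfl; omega
  refine ⟨⟨[X x, X y], rfl, ?_, ?_⟩, ?_⟩
  · have hX : ∀ v : V, (X v : MvPolynomial V k) ∈ WOG.mIdeal k V :=
      fun v => Ideal.subset_span ⟨v, rfl⟩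
    simp [hX]
  · refine ⟨isWeaklyRegular_pair_of_colon X_prime (by simpa [X_dvd_X] using hxy)
      fun s => mem_edgeIdeal_of_X_mul_mem hE hw hx0 hy1, top_ne_smul_top_of_le_mIdeal ?_ ?_⟩
    · refine (Submodule.ne_bot_iff _).2 ⟨X x * X y ^ w y, Ideal.subset_span
        ⟨(x, y), by simp [hE, hx0, hy1], rfl⟩, ?_⟩
      exact mul_ne_zero (X_ne_zero x) (pow_ne_zero _ (X_ne_zero y))
    · refine Ideal.span_le.2 fun r hr => ?_
      have hr' : r = X x ∨ r = X y := by simpa using hr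
      rcases hr' with rfl | rfl
      · exact Ideal.subset_span ⟨x, rfl⟩
      · exact Ideal.subset_span ⟨y, rfl⟩
  · rintro n ⟨rs, rfl, hrs, hreg⟩
    exact length_le_two_of_isWeaklyRegular hm hpart hE hw hw2 hrs hreg.toIsWeaklyRegular
end
end
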